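/- arXiv:2512.09428 — 2 statements merged into one kernel-verified Lean document; each statement's English description precedes it below -/
import Mathlib

section
/- Let K be an algebraically closed field of characteristic 0. Let B_1,…,B_4 be 5×4 matrices over K and c_1,…,c_4 ∈ K^4 such that c_1,…,c_4 are linearly independent and the images of B_1,…,B_4 together span K^5 (the B_i have trivial common cokernel). For i = 1,…,4 let A_i be the 10×10 block matrix, with rows and columns partitioned into blocks of sizes 5, 4, 1, whose only possibly nonzero blocks are the (1,2) block B_i and the (2,3) block c_i. Assume A_1,…,A_4 pairwise commute. Then (A_1,…,A_4) lies in the Zariski closure of the set of simultaneously diagonalizable quadruples of 10×10 matrices: every polynomial over K in the 4·100 matrix entries that vanishes at every simultaneously diagonalizable quadruple of 10×10 matrices also vanishes at (A_1,…,A_4). (This is the matrix form of: every local algebra with Hilbert function (1,4,5) is smoothable.) -/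
open Matrix

/-- A tuple of square matrices is simultaneously diagonalizable. -/
def SimDiag {K : Type*} [Field K] {N ι : Type*} [Fintype ι] [DecidableEq ι]
    (A : N → Matrix ι ι K) : Prop :=
  ∃ P : Matrix ι ι K, IsUnit P ∧ ∀ i, (P⁻¹ * A i * P).IsDiag

/-- A tuple of square matrices lies in the Zariski closure of the set of simultaneously
diagonalizable tuples (the principal component): every polynomial in the matrix entries
vanishing on all simultaneously diagonalizable tuples vanishes at the given tuple. -/
def InSimDiagClosure {K : Type*} [Field K] {N ι : Type*} [Fintype ι] [DecidableEq ι]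
    (A : N → Matrix ι ι K) : Prop :=
  ∀ Φ : MvPolynomial (N × ι × ι) K,
    (∀ B : N → Matrix ι ι K, SimDiag B →
      MvPolynomial.eval (fun x => B x.1 x.2.1 x.2.2) Φ = 0) →
    MvPolynomial.eval (fun x => A x.1 x.2.1 x.2.2) Φ = 0

/-- The 10×10 block matrix with blocks of sizes 5, 4, 1, whose only nonzero blocks are the
(1,2) block `B` and the (2,3) block `c`. -/
def blockMat145 {K : Type*} [Field K] (B : Matrix (Fin 5) (Fin 4) K) (c : Fin 4 → K) :
    Matrix (Fin 5 ⊕ (Fin 4 ⊕ Fin 1)) (Fin 5 ⊕ (Fin 4 ⊕ Fin 1)) K :=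
  Matrix.of fun p q =>
    match p, q with
    | Sum.inl a, Sum.inr (Sum.inl b) => B a b
    | Sum.inr (Sum.inl a), Sum.inr (Sum.inr _) => c a
    | _, _ => 0

theorem MvPolynomial.eval_aeval_polynomial {σ K : Type*} [CommSemiring K]
    (γ : σ → Polynomial K) (F : MvPolynomial σ K) (t : K) :
    (MvPolynomial.aeval γ F).eval t = MvPolynomial.eval (fun i => (γ i).eval t) F := by
  rw [← Polynomial.coe_evalRingHom, MvPolynomial.aeval_def, MvPolynomial.hom_eval₂,
    MvPolynomial.eval, MvPolynomial.coe_eval₂Hom]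
  congr 1
  ext
  simp

/-- A matrix tuple lies in the closure if it is the value of a polynomial curve that stays in the
closure away from the zeros of a nonzero polynomial. -/
theorem InSimDiagClosure.of_curve {K N ι : Type*} [Field K] [Infinite K] [Fintype ι]
    [DecidableEq ι] (γ : N → Matrix ι ι (Polynomial K)) {q : Polynomial K} (hq : q ≠ 0)
    (h : ∀ t, q.eval t ≠ 0 → InSimDiagClosure fun i => (γ i).map (Polynomial.eval t)) (t : K) :
    InSimDiagClosure fun i => (γ i).map (Polynomial.eval t) := by
  intro Φ hΦ
  have hz : MvPolynomial.aeval (fun x : N × ι × ι => γ x.1 x.2.1 x.2.2) Φ * q = 0 := by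
    refine Polynomial.funext fun s => ?_
    rw [Polynomial.eval_mul, MvPolynomial.eval_aeval_polynomial, Polynomial.eval_zero]
    by_cases hs : q.eval s = 0
    · rw [hs, mul_zero]
    · exact mul_eq_zero_of_left (h s hs Φ hΦ) _
  have := congrArg (Polynomial.eval t) ((mul_eq_zero.mp hz).resolve_right hq)
  rwa [MvPolynomial.eval_aeval_polynomial, Polynomial.eval_zero] at this

theorem SimDiag.inSimDiagClosure {K N ι : Type*} [Field K] [Fintype ι] [DecidableEq ι]
    {A : N → Matrix ι ι K} (hA : SimDiag A) : InSimDiagClosure A :=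
  fun _ hΦ => hΦ A hA

theorem SimDiag.of_mul_eq_diagonal_mul {K N ι : Type*} [Field K] [Fintype ι] [DecidableEq ι]
    {A : N → Matrix ι ι K} {E : Matrix ι ι K} (hE : IsUnit E) (d : N → ι → K)
    (h : ∀ i, E * A i = diagonal (d i) * E) : SimDiag A := by
  have hdet := (Matrix.isUnit_iff_isUnit_det E).mp hE
  refine ⟨E⁻¹, (Matrix.isUnit_nonsing_inv_iff).mpr hE, fun i => ?_⟩
  rw [Matrix.nonsing_inv_nonsing_inv _ hdet, h, Matrix.mul_assoc, Matrix.mul_nonsing_inv _ hdet,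
    Matrix.mul_one]
  exact Matrix.isDiag_diagonal _

/-- The closure is stable under linear combinations followed by conjugation. -/
theorem InSimDiagClosure.of_mul_eq_sum_mul {K N ι : Type*} [Field K] [Fintype N] [Fintype ι]
    [DecidableEq ι] {A A' : N → Matrix ι ι K} (hA : InSimDiagClosure A) {Q : Matrix ι ι K}
    (hQ : IsUnit Q) (G : Matrix N N K) (h : ∀ i, A' i * Q = Q * ∑ l, G i l • A l) :
    InSimDiagClosure A' := by
  have hdet := (Matrix.isUnit_iff_isUnit_det Q).mp hQ
  set f : (N → Matrix ι ι K) → N → Matrix ι ι K := fun B i => Q * (∑ l, G i l • B l) * Q⁻¹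
  have hA' : A' = f A := by
    funext i
    simp only [f]
    rw [← h, Matrix.mul_assoc, Matrix.mul_nonsing_inv _ hdet, Matrix.mul_one]
  have hf (B) (hB : SimDiag B) : SimDiag (f B) := by
    obtain ⟨P, hP, hd⟩ := hB
    have hPdet := (Matrix.isUnit_iff_isUnit_det P).mp hP
    refine ⟨Q * P, hQ.mul hP, fun i => ?_⟩
    have : (Q * P)⁻¹ * f B i * (Q * P) = ∑ l, G i l • (P⁻¹ * B l * P) := by
      simp only [f]
      rw [Matrix.mul_inv_rev]
      calc _ = P⁻¹ * (Q⁻¹ * Q) * (∑ l, G i l • B l) * (Q⁻¹ * Q) * P := by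
            simp only [Matrix.mul_assoc]
        _ = _ := by
            rw [Matrix.nonsing_inv_mul _ hdet]
            simp [Matrix.mul_sum, Matrix.sum_mul]
    rw [this]
    intro a b hab
    rw [Matrix.sum_apply]
    exact Finset.sum_eq_zero fun l _ => by rw [Matrix.smul_apply, hd l hab, smul_zero]
  intro Φ hΦ
  let g : N × ι × ι → MvPolynomial (N × ι × ι) K := fun x =>
    ∑ b, (∑ a, MvPolynomial.C (Q x.2.1 a) *
      ∑ l, MvPolynomial.C (G x.1 l) * MvPolynomial.X (l, a, b)) * MvPolynomial.C (Q⁻¹ b x.2.2)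
  have hg (B : N → Matrix ι ι K) :
      MvPolynomial.eval (fun x => B x.1 x.2.1 x.2.2) (MvPolynomial.bind₁ g Φ) =
        MvPolynomial.eval (fun x => f B x.1 x.2.1 x.2.2) Φ := by
    rw [MvPolynomial.eval, MvPolynomial.eval₂Hom_bind₁]
    congr 2
    funext x
    simp [g, f, Matrix.mul_apply, Matrix.sum_apply]
  rw [hA', ← hg]
  exact hA _ fun B hB => by rw [hg]; exact hΦ _ (hf B hB)

theorem MvPolynomial.IsHomogeneous.aeval_const_mul {σ R A : Type*} [CommSemiring R]
    [CommSemiring A] [Algebra R A] {F : MvPolynomial σ R} {n : ℕ} (hF : F.IsHomogeneous n)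
    (a : A) (g : σ → A) :
    MvPolynomial.aeval (fun i => a * g i) F = a ^ n * MvPolynomial.aeval g F := by
  rw [MvPolynomial.aeval_def, MvPolynomial.eval₂_eq, MvPolynomial.aeval_def,
    MvPolynomial.eval₂_eq, Finset.mul_sum]
  refine Finset.sum_congr rfl fun m hm => ?_
  have hm' : ∑ i ∈ m.support, m i = n := by
    rw [← hF (MvPolynomial.mem_support_iff.mp hm), Finsupp.weight_apply, Finsupp.sum]
    simp
  simp_rw [mul_pow, Finset.prod_mul_distrib, Finset.prod_pow_eq_pow_sum, hm']
  ring

open MvPolynomial in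
/-- If through `y` there pass, with every velocity `w`, polynomial curves inside the zero locus
of `F`, then `F = 0`. -/
theorem MvPolynomial.eq_zero_of_forall_exists_curve {σ K : Type*} [Field K] [Infinite K]
    (F : MvPolynomial σ K) (y : σ → K)
    (h : ∀ w : σ → K, ∃ γ : σ → Polynomial K, (∀ i, (γ i).eval 0 = y i) ∧
      (∀ i, (Polynomial.derivative (γ i)).eval 0 = w i) ∧ aeval γ F = 0) :
    F = 0 := by
  set G : MvPolynomial σ K := bind₁ (fun i => X i + C (y i)) F with hG
  have hGF : bind₁ (fun i => X i - C (y i)) G = F := by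
    rw [hG, bind₁_bind₁]
    simp
  suffices hz : ∀ d, homogeneousComponent d G = 0 by
    have : G = 0 := by
      rw [← sum_homogeneousComponent G]
      exact Finset.sum_eq_zero fun d _ => hz d
    rw [← hGF, this, map_zero]
  intro d
  induction d using Nat.strong_induction_on with
  | _ d ih =>
  refine MvPolynomial.funext fun w => ?_
  rw [map_zero]
  obtain ⟨γ, h0, h1, hF⟩ := h w
  have hγ (i) : γ i = Polynomial.X * (γ i).divX + Polynomial.C (y i) := by
    conv_lhs => rw [← Polynomial.X_mul_divX_add (γ i)]
    rw [← h0 i, Polynomial.coeff_zero_eq_eval_zero]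
  have hw (i) : (γ i).divX.eval 0 = w i := by
    rw [← h1 i, ← Polynomial.coeff_zero_eq_eval_zero, ← Polynomial.coeff_zero_eq_eval_zero,
      Polynomial.coeff_divX, Polynomial.coeff_derivative]
    simp
  have hG0 : aeval (fun i => Polynomial.X * (γ i).divX) G = 0 := by
    rw [hG, aeval_bind₁, ← hF]
    congr 2
    funext i
    conv_rhs => rw [hγ i]
    simp
  have hcoeff : (aeval (fun i => Polynomial.X * (γ i).divX) G).coeff d =
      (aeval (fun i => (γ i).divX) (homogeneousComponent d G)).coeff 0 := by
    conv_lhs => rw [← sum_homogeneousComponent G]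
    rw [map_sum, Polynomial.finsetSum_coeff]
    simp_rw [(homogeneousComponent_isHomogeneous _ G).aeval_const_mul,
      Polynomial.coeff_X_pow_mul']
    rw [Finset.sum_eq_single d]
    · simp
    · intro e _ hed
      split_ifs with hle
      · simp [ih e (lt_of_le_of_ne hle hed)]
      · rfl
    · intro hd
      rw [homogeneousComponent_eq_zero _ _ (by simpa using hd)]
      simp
  rw [hG0, Polynomial.coeff_zero, Polynomial.coeff_zero_eq_eval_zero,
    eval_aeval_polynomial] at hcoeff
  rw [hcoeff]
  simp_rw [hw]

theorem blockMat145_eq_fromBlocks {K : Type*} [Field K] (B : Matrix (Fin 5) (Fin 4) K)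
    (c : Fin 4 → K) :
    blockMat145 B c = fromBlocks 0 (fromCols B 0) 0
      (fromBlocks 0 (replicateCol (Fin 1) c) 0 0) := by
  ext (a | a | a) (b | b | b) <;> rfl

theorem sum_smul_blockMat145 {K N : Type*} [Field K] [Fintype N]
    (B : N → Matrix (Fin 5) (Fin 4) K) (c : N → Fin 4 → K) (g : N → K) :
    ∑ l, g l • blockMat145 (B l) (c l) = blockMat145 (∑ l, g l • B l) (∑ l, g l • c l) := by
  ext (a | a | a) (b | b | b) <;> simp [blockMat145, Matrix.sum_apply]

/-- Change of bases in the three blocks and of the generators. -/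
theorem InSimDiagClosure.blockMat145_congr {K N : Type*} [Field K] [Fintype N]
    {B B' : N → Matrix (Fin 5) (Fin 4) K} {c c' : N → Fin 4 → K}
    (h : InSimDiagClosure fun i => blockMat145 (B i) (c i))
    {H : Matrix (Fin 5) (Fin 5) K} {R : Matrix (Fin 4) (Fin 4) K} (hH : IsUnit H) (hR : IsUnit R)
    (G : Matrix N N K) (hB : ∀ i, B' i * R = H * ∑ l, G i l • B l)
    (hc : ∀ i, c' i = R *ᵥ ∑ l, G i l • c l) :
    InSimDiagClosure fun i => blockMat145 (B' i) (c' i) := by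
  refine h.of_mul_eq_sum_mul (Q := fromBlocks H 0 0 (fromBlocks R 0 0 1)) ?_ G fun i => ?_
  · rw [Matrix.isUnit_iff_isUnit_det] at hH hR ⊢
    simpa using And.intro hH.ne_zero hR.ne_zero
  · rw [sum_smul_blockMat145, blockMat145_eq_fromBlocks, blockMat145_eq_fromBlocks, hc]
    simp only [fromBlocks_multiply, fromCols_mul_fromBlocks, mul_fromCols, Matrix.mul_zero,
      Matrix.zero_mul, add_zero, zero_add, Matrix.mul_one, hB, replicateCol_mulVec]

/-- The matrices of the coordinate functions on the ten points `0`, `t • eₗ`, `t • pₖ` of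
`4`-space degenerate to the quadruple attached to the forms `pₖ pₖᵀ - diag pₖ`. -/
theorem inSimDiagClosure_blockMat145_points {K : Type*} [Field K] [Infinite K]
    (p : Fin 5 → Fin 4 → K) :
    InSimDiagClosure fun i => blockMat145
      (Matrix.of fun k j => p k i * p k j - if i = j then p k i else 0) (Pi.single i 1) := by
  let b : Fin 4 → Matrix (Fin 5) (Fin 4) K := fun i =>
    Matrix.of fun k j => p k i * p k j - if i = j then p k i else 0
  let γ : Fin 4 → Matrix (Fin 5 ⊕ (Fin 4 ⊕ Fin 1)) (Fin 5 ⊕ (Fin 4 ⊕ Fin 1)) (Polynomial K) :=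
    fun i => (blockMat145 (b i) (Pi.single i 1)).map Polynomial.C + diagonal
      (Sum.elim (fun k => Polynomial.C (p k i) * Polynomial.X)
        (Sum.elim (fun l => if i = l then Polynomial.X else 0) 0))
  have key := InSimDiagClosure.of_curve γ (q := Polynomial.X) Polynomial.X_ne_zero ?_ 0
  · convert key using 2 with i
    ext (a | a | a) (c | c | c) <;>
      simp [γ, b, blockMat145, diagonal_apply, apply_ite (Polynomial.eval _)]
  · intro t ht
    rw [Polynomial.eval_X] at ht
    refine (SimDiag.of_mul_eq_diagonal_mul (E := fromBlocks (diagonal fun _ => t ^ 2)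
      (Matrix.of fun k => Sum.elim (fun j => t * p k j) 1) 0
      (fromBlocks (diagonal fun _ => t) (Matrix.of 1) 0 1)) ?_
      (fun i => Sum.elim (fun k => t * p k i) (Sum.elim (fun l => if i = l then t else 0) 0))
      fun i => ?_).inSimDiagClosure
    · rw [Matrix.isUnit_iff_isUnit_det]
      simp [ht]
    · ext (a | a | a) (c | c | c) <;>
        simp [γ, b, blockMat145, diagonal_apply, Matrix.mul_apply, Pi.single_apply,
          Matrix.one_apply, apply_ite (Polynomial.eval _)]
      · split_ifs with hac
        · rw [hac]
          ring
        · ring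
      · split_ifs with hic
        · rw [hic]
          ring
        · ring
      · by_cases hia : i = a <;> by_cases hac : a = c <;> simp_all
      · simp only [eq_comm]

/-- The quadratic forms `pₖ pₖᵀ - diag pₖ` after the change of variables `g` and the change of
basis `h`. -/
def transformedForms {R : Type*} [CommRing R] (h : Matrix (Fin 5) (Fin 5) R)
    (g : Matrix (Fin 4) (Fin 4) R) (p : Fin 5 → Fin 4 → R) (k : Fin 5) (i j : Fin 4) : R :=
  ∑ m, h k m * ∑ l, ∑ n, g l i * (p m l * p m n - if l = n then p m l else 0) * g n j

theorem map_transformedForms {R S : Type*} [CommRing R] [CommRing S] (f : R →+* S)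
    (h : Matrix (Fin 5) (Fin 5) R) (g : Matrix (Fin 4) (Fin 4) R) (p : Fin 5 → Fin 4 → R)
    (k : Fin 5) (i j : Fin 4) :
    f (transformedForms h g p k i j) =
      transformedForms (h.map f) (g.map f) (fun m l => f (p m l)) k i j := by
  simp [transformedForms, apply_ite f]

theorem transformedForms_comm {R : Type*} [CommRing R] (h : Matrix (Fin 5) (Fin 5) R)
    (g : Matrix (Fin 4) (Fin 4) R) (p : Fin 5 → Fin 4 → R) (k : Fin 5) (i j : Fin 4) :
    transformedForms h g p k i j = transformedForms h g p k j i := by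
  unfold transformedForms
  refine Finset.sum_congr rfl fun m _ => congrArg _ ?_
  rw [Finset.sum_comm]
  refine Finset.sum_congr rfl fun l _ => Finset.sum_congr rfl fun n _ => ?_
  by_cases hln : l = n
  · subst hln
    ring
  · rw [if_neg hln, if_neg (Ne.symm hln)]
    ring

/-- Five points at which the forms `pₖ pₖᵀ - diag pₖ` deform in all directions. -/
def basePoints (R : Type*) [Ring R] : Fin 5 → Fin 4 → R :=
  ![![-1, 0, -1, 0], ![0, 1, 0, 1], ![1, 0, 1, 0], ![0, 0, 1, 1], ![1, 1, 0, 0]]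

set_option maxHeartbeats 1600000 in
theorem exists_tangent_basePoints {K : Type*} [Field K] [CharZero K]
    (w : Fin 5 → Fin 4 → Fin 4 → K) (hw : ∀ k i j, w k i j = w k j i) :
    ∃ (u : Fin 5 → Fin 4 → K) (g : Matrix (Fin 4) (Fin 4) K) (h : Matrix (Fin 5) (Fin 5) K),
      ∀ k i j, w k i j =
        (basePoints K k i * u k j + u k i * basePoints K k j - if i = j then u k i else 0) +
        ∑ l, (g l i * transformedForms 1 1 (basePoints K) k l j +
          transformedForms 1 1 (basePoints K) k i l * g l j) +
        ∑ m, h k m * transformedForms 1 1 (basePoints K) m i j := by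
  have hform (k i j) : transformedForms 1 1 (basePoints K) k i j =
      basePoints K k i * basePoints K k j - if i = j then basePoints K k i else 0 := by
    simp [transformedForms, Matrix.one_apply]
  have h10 (k) := hw k 1 0
  have h20 (k) := hw k 2 0
  have h30 (k) := hw k 3 0
  have h21 (k) := hw k 2 1
  have h31 (k) := hw k 3 1
  have h32 (k) := hw k 3 2
  simp only [hform]
  refine ⟨![![-w 0 0 0 / 3, -w 0 1 1, -w 0 2 2 / 3 + 2 * w 4 1 2 / 3, -w 0 3 3],
      ![-w 1 0 0, w 1 1 1 - 2 * w 3 1 1 - 2 * w 3 1 2, -w 1 2 2,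
        w 1 3 3 - 2 * w 4 0 3 - 2 * w 4 3 3],
      ![w 2 0 0, -w 2 1 1, w 2 2 2 - 2 * w 4 1 2, -w 2 3 3],
      ![w 3 0 3, -w 3 1 1, -2 * w 1 1 2 - 2 * w 1 2 2 - w 3 0 0 - w 3 0 3 + w 3 2 2,
        -2 * w 2 0 3 - 2 * w 2 3 3 + w 3 3 3],
      ![-2 * w 1 0 0 - 2 * w 1 0 3 + w 4 0 0 - w 4 2 2, -2 * w 2 1 1 - 2 * w 2 1 2 + w 4 1 1, 0,
        -w 4 3 3]],
    Matrix.of ![![0, w 2 1 1 + w 2 1 2, w 4 1 2,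
        w 0 0 3 / 2 - w 0 3 3 / 2 - w 2 0 3 / 2 - w 2 3 3 / 2],
      ![w 1 0 0 + w 1 0 3, 0, 0, w 4 0 3 + w 4 3 3],
      ![0, -w 0 1 1 / 2 + w 0 1 2 / 2 - w 2 1 1 / 2 - w 2 1 2 / 2, 0, w 2 0 3 + w 2 3 3],
      ![0, w 3 1 1 + w 3 1 2, w 1 1 2 + w 1 2 2, 0]],
    Matrix.of ![![0, w 0 1 3, -w 0 0 0 / 3 + w 0 0 2 - w 0 2 2 / 3 - 4 * w 4 1 2 / 3,
        -w 0 0 3 / 2 + w 0 2 3 - w 0 3 3 / 2 - 3 * w 2 0 3 / 2 - 3 * w 2 3 3 / 2,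
        w 0 0 1 - w 0 1 1 / 2 - w 0 1 2 / 2 - 3 * w 2 1 1 / 2 - 3 * w 2 1 2 / 2],
      ![0, -w 1 1 1 + w 1 1 3 - w 1 3 3 + 2 * w 3 1 1 + 2 * w 3 1 2 + 2 * w 4 0 3 + 2 * w 4 3 3,
        w 1 0 2, w 1 2 2 + w 1 2 3, w 1 0 0 + w 1 0 1],
      ![0, w 2 1 3, -w 2 0 0 + w 2 0 2 - w 2 2 2 + 2 * w 4 1 2,
        -w 0 0 3 / 2 + w 0 3 3 / 2 + w 2 0 3 / 2 + w 2 2 3 + 3 * w 2 3 3 / 2,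
        w 0 1 1 / 2 - w 0 1 2 / 2 + w 2 0 1 + 3 * w 2 1 1 / 2 + w 2 1 2 / 2],
      ![w 3 0 0 / 2 + w 3 0 3 / 2, w 0 1 1 / 2 - w 0 1 2 / 2 + w 2 1 1 / 2 + w 2 1 2 / 2 +
        w 3 1 1 + w 3 1 3, -w 3 0 0 / 2 + w 3 0 2 - 3 * w 3 0 3 / 2,
        2 * w 1 1 2 + 2 * w 1 2 2 + 2 * w 2 0 3 + 2 * w 2 3 3 + w 3 0 0 + w 3 0 3 - w 3 2 2 +
        w 3 2 3 - w 3 3 3, w 3 0 1],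
      ![w 4 2 2 / 2, -w 0 0 3 / 2 + w 0 3 3 / 2 + w 2 0 3 / 2 + w 2 3 3 / 2 + w 4 1 3 + w 4 3 3,
        w 4 0 2 - w 4 2 2 / 2, w 4 2 3, 2 * w 1 0 0 + 2 * w 1 0 3 + 2 * w 2 1 1 +
        2 * w 2 1 2 - w 4 0 0 + w 4 0 1 - w 4 1 1 + w 4 2 2]],
    fun k i j => ?_⟩
  fin_cases k <;> fin_cases i <;> fin_cases j <;>
    simp [basePoints, Fin.sum_univ_four, Fin.sum_univ_five, h10, h20, h30, h21, h31, h32] <;> ring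

/-- The velocity at `0` of a curve of transformed forms with `h = 1` and `g = 1` at `0`. -/
theorem eval_zero_derivative_transformedForms {R : Type*} [CommRing R]
    {h' : Matrix (Fin 5) (Fin 5) (Polynomial R)} {g' : Matrix (Fin 4) (Fin 4) (Polynomial R)}
    {p' : Fin 5 → Fin 4 → Polynomial R} {h : Matrix (Fin 5) (Fin 5) R}
    {g : Matrix (Fin 4) (Fin 4) R} {p u : Fin 5 → Fin 4 → R}
    (hh : ∀ k m, (h' k m).eval 0 = (1 : Matrix (Fin 5) (Fin 5) R) k m)
    (hh' : ∀ k m, (Polynomial.derivative (h' k m)).eval 0 = h k m)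
    (hg : ∀ i j, (g' i j).eval 0 = (1 : Matrix (Fin 4) (Fin 4) R) i j)
    (hg' : ∀ i j, (Polynomial.derivative (g' i j)).eval 0 = g i j)
    (hp : ∀ k i, (p' k i).eval 0 = p k i)
    (hp' : ∀ k i, (Polynomial.derivative (p' k i)).eval 0 = u k i) (k : Fin 5) (i j : Fin 4) :
    (Polynomial.derivative (transformedForms h' g' p' k i j)).eval 0 =
      (p k i * u k j + u k i * p k j - if i = j then u k i else 0) +
      ∑ l, (g l i * transformedForms 1 1 p k l j + transformedForms 1 1 p k i l * g l j) +
      ∑ m, h k m * transformedForms 1 1 p m i j := by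
  have hM (m l n) : (p' m l * p' m n - if l = n then p' m l else 0).eval 0 =
      transformedForms 1 1 p m l n := by
    simp [transformedForms, apply_ite (Polynomial.eval (0 : R)), hp, Matrix.one_apply]
  have hM' (m l n) : (Polynomial.derivative
      (p' m l * p' m n - if l = n then p' m l else 0)).eval 0 =
      u m l * p m n + p m l * u m n - if l = n then u m l else 0 := by
    simp [apply_ite Polynomial.derivative, apply_ite (Polynomial.eval (0 : R)), hp, hp']
  rw [transformedForms]
  simp only [Polynomial.derivative_sum, Polynomial.derivative_mul, Polynomial.eval_finsetSum,
    Polynomial.eval_add, Polynomial.eval_mul, hM, hM', hh, hh', hg, hg', Matrix.one_apply,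
    mul_ite, ite_mul, mul_one, one_mul, mul_zero, zero_mul, Finset.sum_add_distrib, mul_add,
    add_mul, Finset.sum_ite_eq, Finset.sum_ite_eq', Finset.mem_univ, if_true,
    Finset.sum_ite_irrel, Finset.sum_const_zero]
  ring

theorem inSimDiagClosure_transformedForms {K : Type*} [Field K] [Infinite K]
    {h : Matrix (Fin 5) (Fin 5) K} {g : Matrix (Fin 4) (Fin 4) K} (hh : IsUnit h) (hg : IsUnit g)
    (p : Fin 5 → Fin 4 → K) :
    InSimDiagClosure fun i => blockMat145
      (Matrix.of fun k j => transformedForms h g p k i j) (Pi.single i 1) := by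
  have hdet := (Matrix.isUnit_iff_isUnit_det g).mp hg
  refine (inSimDiagClosure_blockMat145_points p).blockMat145_congr hh
    (Matrix.isUnit_nonsing_inv_iff.mpr hg) gᵀ (fun i => ?_) fun i => ?_
  · have : (Matrix.of fun k j => transformedForms h g p k i j) = h * (∑ l, gᵀ i l •
        Matrix.of fun k j => p k l * p k j - if l = j then p k l else 0) * g := by
      ext k j
      simp only [transformedForms, Matrix.mul_apply, Matrix.sum_apply, Matrix.smul_apply,
        Matrix.of_apply, Matrix.transpose_apply, smul_eq_mul, Finset.mul_sum, Finset.sum_mul,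
        mul_assoc]
      exact (Finset.sum_congr rfl fun m _ => Finset.sum_comm).trans Finset.sum_comm
    rw [this, Matrix.mul_assoc, Matrix.mul_nonsing_inv _ hdet, Matrix.mul_one]
  · have : ∑ l, gᵀ i l • Pi.single l 1 = g *ᵥ Pi.single i (1 : K) := by
      ext j
      simp [Finset.sum_apply, Pi.single_apply]
    rw [this, Matrix.mulVec_mulVec, Matrix.nonsing_inv_mul _ hdet, Matrix.one_mulVec]

theorem exists_curve_transformedForms {K : Type*} [Field K] [CharZero K]
    (w : Fin 5 → Fin 4 → Fin 4 → K) (hw : ∀ k i j, w k i j = w k j i) :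
    ∃ (h : Matrix (Fin 5) (Fin 5) (Polynomial K)) (g : Matrix (Fin 4) (Fin 4) (Polynomial K))
      (p : Fin 5 → Fin 4 → Polynomial K),
      h.map (Polynomial.evalRingHom 0) = 1 ∧ g.map (Polynomial.evalRingHom 0) = 1 ∧
      (∀ k i, Polynomial.evalRingHom 0 (p k i) = basePoints K k i) ∧
      ∀ k i j, (Polynomial.derivative (transformedForms h g p k i j)).eval 0 = w k i j := by
  obtain ⟨u, g, h, huw⟩ := exists_tangent_basePoints w hw
  refine ⟨Matrix.of fun k m =>
      Polynomial.C ((1 : Matrix _ _ K) k m) + Polynomial.C (h k m) * Polynomial.X,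
    Matrix.of fun i j =>
      Polynomial.C ((1 : Matrix _ _ K) i j) + Polynomial.C (g i j) * Polynomial.X,
    fun k i => Polynomial.C (basePoints K k i) + Polynomial.C (u k i) * Polynomial.X,
    ?_, ?_, ?_, fun k i j => ?_⟩
  · ext
    simp
  · ext
    simp
  · simp
  · rw [huw]
    apply eval_zero_derivative_transformedForms <;> simp

/-- Any five quadratic forms in four variables give a quadruple in the closure. -/
theorem inSimDiagClosure_blockMat145_symm {K : Type*} [Field K] [CharZero K]
    (b : Fin 5 → Fin 4 → Fin 4 → K) (hb : ∀ k i j, b k i j = b k j i) :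
    InSimDiagClosure fun i => blockMat145 (Matrix.of fun k j => b k i j) (Pi.single i 1) := by
  intro Φ hΦ
  let entry : Fin 4 × (Fin 5 ⊕ (Fin 4 ⊕ Fin 1)) × (Fin 5 ⊕ (Fin 4 ⊕ Fin 1)) →
      MvPolynomial (Fin 5 × Sym2 (Fin 4)) K
    | (i, Sum.inl k, Sum.inr (Sum.inl j)) => MvPolynomial.X (k, s(i, j))
    | (i, Sum.inr (Sum.inl l), Sum.inr (Sum.inr _)) =>
      MvPolynomial.C ((Pi.single i 1 : Fin 4 → K) l)
    | _ => 0
  set F := MvPolynomial.bind₁ entry Φ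
  have hF (w : Fin 5 × Sym2 (Fin 4) → K) : MvPolynomial.eval w F =
      MvPolynomial.eval (fun x => blockMat145 (Matrix.of fun k j => w (k, s(x.1, j)))
        (Pi.single x.1 1) x.2.1 x.2.2) Φ := by
    rw [MvPolynomial.eval, MvPolynomial.eval₂Hom_bind₁]
    congr 2
    funext ⟨i, a, c⟩
    rcases a with a | a | a <;> rcases c with c | c | c <;> simp [entry, blockMat145]
  let onSym2 (R : Type _) (f : Fin 5 → Fin 4 → Fin 4 → R) (hf : ∀ k i j, f k i j = f k j i) :
      Fin 5 × Sym2 (Fin 4) → R :=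
    fun x => Sym2.lift ⟨f x.1, hf x.1⟩ x.2
  suffices hF0 : F = 0 by
    have := hF (onSym2 K b hb)
    rw [hF0, map_zero] at this
    exact this.symm
  refine F.eq_zero_of_forall_exists_curve
    (onSym2 K (transformedForms 1 1 (basePoints K)) (transformedForms_comm _ _ _)) fun w => ?_
  obtain ⟨h, g, p, hh, hg, hp, hw⟩ := exists_curve_transformedForms
    (fun k i j => w (k, s(i, j))) fun k i j => by rw [Sym2.eq_swap]
  have hdet (t : K) : (h.det * g.det).eval t =
      (h.map (Polynomial.evalRingHom t)).det * (g.map (Polynomial.evalRingHom t)).det := by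
    rw [← RingHom.mapMatrix_apply, ← RingHom.mapMatrix_apply, ← RingHom.map_det,
      ← RingHom.map_det, ← map_mul, Polynomial.coe_evalRingHom]
  refine ⟨onSym2 _ (transformedForms h g p) (transformedForms_comm _ _ _), ?_, ?_, ?_⟩
  · rintro ⟨k, z⟩
    induction z with | _ i j
    change Polynomial.evalRingHom 0 (transformedForms h g p k i j) =
      transformedForms 1 1 (basePoints K) k i j
    simp_rw [map_transformedForms, hg, hh, hp]
  · rintro ⟨k, z⟩
    induction z with | _ i j
    exact hw k i j
  · have hq : h.det * g.det ≠ 0 := by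
      intro h0
      have h1 := hdet 0
      rw [h0, hh, hg, Matrix.det_one, Matrix.det_one, Polynomial.eval_zero, mul_one] at h1
      exact zero_ne_one h1
    refine (mul_eq_zero.mp (Polynomial.funext fun t => ?_)).resolve_right hq
    rw [Polynomial.eval_mul, MvPolynomial.eval_aeval_polynomial, Polynomial.eval_zero]
    by_cases ht : (h.det * g.det).eval t = 0
    · rw [ht, mul_zero]
    · refine mul_eq_zero_of_left ?_ _
      rw [hdet] at ht
      have key := inSimDiagClosure_transformedForms
        ((Matrix.isUnit_iff_isUnit_det _).mpr (left_ne_zero_of_mul ht).isUnit)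
        ((Matrix.isUnit_iff_isUnit_det _).mpr (right_ne_zero_of_mul ht).isUnit)
        (fun k i => Polynomial.evalRingHom t (p k i)) Φ hΦ
      simp_rw [← map_transformedForms] at key
      rw [hF]
      exact key

/-- **Proposition 5.2 (HF:145).** Every local algebra with Hilbert function (1,4,5)
is smoothable, in matrix form. -/
theorem stmt12 {K : Type*} [Field K] [CharZero K] [IsAlgClosed K]
    (B : Fin 4 → Matrix (Fin 5) (Fin 4) K) (c : Fin 4 → (Fin 4 → K))
    (A : Fin 4 → Matrix (Fin 5 ⊕ (Fin 4 ⊕ Fin 1)) (Fin 5 ⊕ (Fin 4 ⊕ Fin 1)) K)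
    (hA : A = fun i => blockMat145 (B i) (c i))
    (hc : LinearIndependent K c)
    (hB : (⨆ i, LinearMap.range (Matrix.mulVecLin (B i))) = ⊤)
    (hcomm : ∀ i j, A i * A j = A j * A i) :
    InSimDiagClosure A := by
  subst hA
  have hbc (i j) : B i *ᵥ c j = B j *ᵥ c i := by
    ext k
    have := congrFun (congrFun (hcomm i j) (Sum.inl k)) (Sum.inr (Sum.inr 0))
    simpa [Matrix.mul_apply, blockMat145, Matrix.mulVec, dotProduct] using this
  have hR : IsUnit (Matrix.of c)ᵀ := by
    rw [Matrix.isUnit_transpose, ← Matrix.linearIndependent_rows_iff_isUnit]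
    exact hc
  refine (inSimDiagClosure_blockMat145_symm (fun k i j => (B i *ᵥ c j) k)
    fun k i j => by rw [hbc]).blockMat145_congr isUnit_one hR 1 (fun i => ?_) fun i => ?_
  · ext k j
    simp [Matrix.one_apply, Matrix.mul_apply, Matrix.mulVec, dotProduct]
  · ext k
    simp [Matrix.one_apply]
end

section
/- Let K be an algebraically closed field of characteristic 0, let n ≥ 4 and r ≥ 1 with n + r ≤ 8, and set d = n + r + 2. Given vectors b_1,…,b_n ∈ K^r, c_1,…,c_n ∈ K^n, f_1,…,f_n ∈ K^n and matrices D_1,…,D_n ∈ M_{r×n}(K), for i = 1,…,n let A_i denote the d×d matrix with rows and columns partitioned into blocks of sizes 1, r, n, 1, whose only possibly nonzero blocks are the (1,2) block b_iᵀ, the (1,3) block c_iᵀ, the (2,3) block D_i and the (3,4) block f_i. Assume: A_1,…,A_n pairwise commute; f_1,…,f_n are linearly independent; the images of D_1,…,D_n together span K^r; not all b_i are zero; and the common kernel ⋂_{i=1}^n ker A_i has dimension 2. Then (A_1,…,A_n) lies in the Zariski closure of the set of simultaneously diagonalizable n-tuples of d×d matrices. (This is the matrix form of: every local algebra with Hilbert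 function (1,n,r,1) and socle dimension 2 is smoothable.) -/
open Matrix

/-- The `d×d` block matrix (`d = 1 + r + n + 1`) with blocks of sizes 1, r, n, 1, whose only
nonzero blocks are the (1,2) block `bᵀ`, the (1,3) block `cᵀ`, the (2,3) block `D` and the
(3,4) block `f`. -/
def blockMat1rn1 {K : Type*} [Field K] {r n : ℕ} (b : Fin r → K) (c : Fin n → K)
    (D : Matrix (Fin r) (Fin n) K) (f : Fin n → K) :
    Matrix (Fin 1 ⊕ (Fin r ⊕ (Fin n ⊕ Fin 1))) (Fin 1 ⊕ (Fin r ⊕ (Fin n ⊕ Fin 1))) K :=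
  Matrix.of fun p q =>
    match p, q with
    | Sum.inl _, Sum.inr (Sum.inl a) => b a
    | Sum.inl _, Sum.inr (Sum.inr (Sum.inl a)) => c a
    | Sum.inr (Sum.inl a), Sum.inr (Sum.inr (Sum.inl a')) => D a a'
    | Sum.inr (Sum.inr (Sum.inl a)), Sum.inr (Sum.inr (Sum.inr _)) => f a
    | _, _ => 0

open Module

section Closure

variable {K : Type*} [Field K]

theorem eval_aeval {α β : Type*} (g : β → MvPolynomial α K) (a : α → K) (Φ : MvPolynomial β K) :
    MvPolynomial.eval a (MvPolynomial.aeval g Φ) =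
      MvPolynomial.eval (fun x => MvPolynomial.eval a (g x)) Φ := by
  rw [← MvPolynomial.aeval_eq_eval, ← MvPolynomial.aeval_eq_eval]
  exact MvPolynomial.comp_aeval_apply (φ := MvPolynomial.aeval a) (f := g) Φ

/-- A polynomial map preserving simultaneous diagonalizability preserves the principal
component. -/
theorem InSimDiagClosure.map {N N' ι κ : Type*} [Fintype ι] [DecidableEq ι] [Fintype κ]
    [DecidableEq κ] {A : N → Matrix ι ι K} (hA : InSimDiagClosure A)
    (g : N' × κ × κ → MvPolynomial (N × ι × ι) K) (G : (N → Matrix ι ι K) → N' → Matrix κ κ K)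
    (hG : ∀ B i j k, G B i j k = MvPolynomial.eval (fun x => B x.1 x.2.1 x.2.2) (g (i, j, k)))
    (h : ∀ B, SimDiag B → SimDiag (G B)) : InSimDiagClosure (G A) := by
  intro Φ hΦ
  have key : ∀ B : N → Matrix ι ι K,
      MvPolynomial.eval (fun x => B x.1 x.2.1 x.2.2) (MvPolynomial.aeval g Φ) =
      MvPolynomial.eval (fun x => G B x.1 x.2.1 x.2.2) Φ := by
    intro B
    rw [eval_aeval]
    simp only [hG]
  rw [← key]
  refine hA _ fun B hB => ?_
  rw [key]
  exact hΦ _ (h B hB)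

theorem InSimDiagClosure.conj {N ι κ : Type*} [Fintype ι] [DecidableEq ι] [Fintype κ]
    [DecidableEq κ] {A : N → Matrix ι ι K} (hA : InSimDiagClosure A)
    (P : Matrix κ ι K) (P' : Matrix ι κ K) (h : P * P' = 1) (h' : P' * P = 1) :
    InSimDiagClosure fun i => P * A i * P' := by
  refine hA.map (fun x : N × κ × κ =>
    ∑ k, (∑ j, MvPolynomial.C (P x.2.1 j) * MvPolynomial.X (x.1, j, k)) *
      MvPolynomial.C (P' k x.2.2)) (fun B i => P * B i * P') (fun B i j k => ?_) ?_
  · simp only [Matrix.mul_apply, map_sum, map_mul, MvPolynomial.eval_C, MvPolynomial.eval_X]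
  rintro B ⟨R, hR, hB⟩
  have hcard : Fintype.card κ = Fintype.card ι := Matrix.square_of_invertible P P' h h'
  obtain ⟨σ⟩ : Nonempty (κ ≃ ι) := Fintype.card_eq.mp hcard
  have hRi' : R⁻¹ * R = 1 := Matrix.nonsing_inv_mul _ ((Matrix.isUnit_iff_isUnit_det _).mp hR)
  have e1 : ((R⁻¹ * P').submatrix σ id) * ((P * R).submatrix id σ) = 1 := by
    rw [← Matrix.submatrix_mul _ _ _ _ _ Function.bijective_id]
    rw [show R⁻¹ * P' * (P * R) = R⁻¹ * (P' * P) * R by simp only [Matrix.mul_assoc], h',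
      Matrix.mul_one, hRi', Matrix.submatrix_one_equiv]
  have e2 : ((P * R).submatrix id σ)⁻¹ = (R⁻¹ * P').submatrix σ id :=
    Matrix.inv_eq_left_inv e1
  refine ⟨(P * R).submatrix id σ, ?_, fun i => ?_⟩
  · rw [Matrix.isUnit_iff_isUnit_det]
    exact Matrix.isUnit_det_of_left_inverse e1
  · rw [e2]
    have : ((R⁻¹ * P').submatrix σ id) * (P * B i * P') * ((P * R).submatrix id σ) =
        (R⁻¹ * B i * R).submatrix σ σ := by
      rw [show (P * B i * P') = (P * B i * P').submatrix id id by simp,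
        ← Matrix.submatrix_mul _ _ _ _ _ Function.bijective_id,
        ← Matrix.submatrix_mul _ _ _ _ _ Function.bijective_id]
      congr 1
      calc R⁻¹ * P' * (P * B i * P') * (P * R)
          = R⁻¹ * (P' * P) * B i * (P' * P) * R := by simp only [Matrix.mul_assoc]
        _ = _ := by rw [h', Matrix.mul_one, Matrix.mul_one]
    rw [this]
    intro a c hac
    exact hB i (fun hh => hac (σ.injective hh))

theorem InSimDiagClosure.of_simDiag {N ι : Type*} [Fintype ι] [DecidableEq ι]
    {A : N → Matrix ι ι K} (hA : SimDiag A) : InSimDiagClosure A :=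
  fun _ h => h A hA

theorem InSimDiagClosure.of_quadratic_family [CharZero K] {N ι : Type*} [Fintype ι]
    [DecidableEq ι] {A A₁ A₂ : N → Matrix ι ι K}
    (h : ∀ τ : K, τ ≠ 0 → InSimDiagClosure fun i => A i + τ • A₁ i + τ ^ 2 • A₂ i) :
    InSimDiagClosure A := by
  intro Φ hΦ
  set p : Polynomial K := MvPolynomial.aeval (fun x : N × ι × ι =>
    Polynomial.C (A x.1 x.2.1 x.2.2) + Polynomial.X * Polynomial.C (A₁ x.1 x.2.1 x.2.2) +
      Polynomial.X ^ 2 * Polynomial.C (A₂ x.1 x.2.1 x.2.2)) Φ with hp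
  have key : ∀ τ : K, p.eval τ = MvPolynomial.eval
      (fun x => (A x.1 + τ • A₁ x.1 + τ ^ 2 • A₂ x.1) x.2.1 x.2.2) Φ := by
    intro τ
    rw [hp, ← Polynomial.coe_aeval_eq_eval, MvPolynomial.comp_aeval_apply,
      MvPolynomial.aeval_eq_eval]
    simp only [map_add, map_mul, map_pow, Polynomial.coe_aeval_eq_eval, Polynomial.eval_C,
      Polynomial.eval_X, Matrix.add_apply, Matrix.smul_apply, smul_eq_mul]
  have hp0 : p = 0 := by
    apply Polynomial.eq_zero_of_infinite_isRoot
    refine Set.Infinite.mono (s := {0}ᶜ) (fun τ hτ => ?_) (Set.finite_singleton 0).infinite_compl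
    change p.eval τ = 0
    rw [key]
    exact h τ hτ Φ hΦ
  have := key 0
  simpa [hp0] using this.symm

theorem InSimDiagClosure.fromBlocks_diagonal {N ι κ : Type*} [Fintype ι] [DecidableEq ι]
    [Fintype κ] [DecidableEq κ] {A : N → Matrix ι ι K} (hA : InSimDiagClosure A)
    (d : N → κ → K) :
    InSimDiagClosure fun i => Matrix.fromBlocks (A i) 0 0 (Matrix.diagonal (d i)) := by
  refine hA.map (fun x : N × (ι ⊕ κ) × (ι ⊕ κ) => Matrix.fromBlocks
      (Matrix.of fun j k => (MvPolynomial.X (x.1, j, k) : MvPolynomial (N × ι × ι) K)) 0 0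
      (Matrix.diagonal fun k => MvPolynomial.C (d x.1 k)) x.2.1 x.2.2)
    (fun B i => Matrix.fromBlocks (B i) 0 0 (Matrix.diagonal (d i))) (fun B i j k => ?_) ?_
  · rcases j with j | j <;> rcases k with k | k <;> simp [Matrix.diagonal_apply]
    split_ifs <;> simp
  rintro B ⟨R, hR, hB⟩
  have hRi' : R⁻¹ * R = 1 := Matrix.nonsing_inv_mul _ ((Matrix.isUnit_iff_isUnit_det _).mp hR)
  have e1 : (Matrix.fromBlocks R⁻¹ 0 0 (1 : Matrix κ κ K)) * (Matrix.fromBlocks R 0 0 1) = 1 := by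
    simp [Matrix.fromBlocks_multiply, hRi']
  refine ⟨Matrix.fromBlocks R 0 0 1, ?_, fun i => ?_⟩
  · rw [Matrix.isUnit_iff_isUnit_det]
    exact Matrix.isUnit_det_of_left_inverse e1
  · rw [Matrix.inv_eq_left_inv e1]
    simp only [Matrix.fromBlocks_multiply, Matrix.mul_zero, Matrix.zero_mul, add_zero, zero_add,
      Matrix.one_mul, Matrix.mul_one]
    rintro (a | a) (c | c) hac
    · exact hB i (fun hh => hac (by rw [hh]))
    · rfl
    · rfl
    · exact Matrix.diagonal_apply_ne _ (fun hh => hac (by rw [hh]))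

end Closure

section EndClosure

variable {K : Type*} [Field K] {V V' : Type*} [AddCommGroup V] [Module K V] [AddCommGroup V']
  [Module K V']

/-- A tuple of endomorphisms lies in the principal component, in every basis. -/
def EndClosure {N : Type*} (T : N → Module.End K V) : Prop :=
  ∀ (ι : Type) [Fintype ι] [DecidableEq ι] (b : Basis ι K V),
    InSimDiagClosure fun i => LinearMap.toMatrix b b (T i)

theorem EndClosure.of_basis {N ι : Type*} [Fintype ι] [DecidableEq ι] {T : N → Module.End K V}
    (b : Basis ι K V) (h : InSimDiagClosure fun i => LinearMap.toMatrix b b (T i)) :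
    EndClosure T := by
  intro κ _ _ b'
  have := h.conj (b'.toMatrix b) (b.toMatrix b') (by simp) (by simp)
  simpa only [basis_toMatrix_mul_linearMap_toMatrix_mul_basis_toMatrix] using this

theorem EndClosure.transport {N : Type*} {T : N → Module.End K V} {T' : N → Module.End K V'}
    (h : EndClosure T) (e : V ≃ₗ[K] V') (he : ∀ i v, e (T i v) = T' i (e v)) :
    EndClosure T' := by
  intro ι _ _ b
  have := h ι (b.map e.symm)
  convert this using 2 with i
  ext j k
  simp [LinearMap.toMatrix_apply, he]

theorem EndClosure.of_quadratic_family [CharZero K] [Module.Finite K V] {N : Type*}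
    {T T₁ T₂ : N → Module.End K V}
    (h : ∀ τ : K, τ ≠ 0 → EndClosure fun i => T i + τ • T₁ i + τ ^ 2 • T₂ i) :
    EndClosure T := by
  intro ι _ _ b
  refine InSimDiagClosure.of_quadratic_family (A₁ := fun i => LinearMap.toMatrix b b (T₁ i))
    (A₂ := fun i => LinearMap.toMatrix b b (T₂ i)) fun τ hτ => ?_
  simpa only [map_add, map_smul] using h τ hτ ι b

theorem EndClosure.prodMap_mulLeft [Module.Finite K V] {N κ : Type*} [Fintype κ]
    {T : N → Module.End K V} (h : EndClosure T) (d : N → κ → K) :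
    EndClosure fun i => (T i).prodMap (LinearMap.mulLeft K (d i)) := by
  classical
  let b := Module.finBasis K V
  refine EndClosure.of_basis (b.prod (Pi.basisFun K κ)) ?_
  convert (h _ b).fromBlocks_diagonal d using 2 with i
  rw [LinearMap.toMatrix_prodMap]
  congr 1
  ext j k
  simp [Matrix.diagonal_apply, Pi.single_apply]

end EndClosure

section Smooth

variable {K : Type*} [Field K] {m m' : Type*} [AddCommGroup m] [Module K m] [AddCommGroup m']
  [Module K m']

/-- The operator of multiplication by `z` on the unitization `K × m` of the algebra `(m, μ)`. -/
def unitMul (μ : m → m →ₗ[K] m) (z : m) : Module.End K (K × m) :=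
  (LinearMap.inr K K m).comp ((LinearMap.toSpanSingleton K m z).coprod (μ z))

@[simp]
theorem unitMul_apply (μ : m → m →ₗ[K] m) (z : m) (v : K × m) :
    unitMul μ z v = (0, v.1 • z + μ z v.2) := by
  simp [unitMul]

/-- Every tuple of multiplication operators of the unitization of `(m, μ)` lies in the principal
component. -/
def Smooth (μ : m → m →ₗ[K] m) : Prop :=
  ∀ (N : Type) (z : N → m), EndClosure fun i => unitMul μ (z i)

theorem Smooth.transport {μ : m → m →ₗ[K] m} {μ' : m' → m' →ₗ[K] m'} (h : Smooth μ)
    (e : m ≃ₗ[K] m') (he : ∀ z v, e (μ z v) = μ' (e z) (e v)) : Smooth μ' := by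
  intro N z
  refine (h N fun i => e.symm (z i)).transport ((LinearEquiv.refl K K).prodCongr e) fun i v => ?_
  simp [he]

theorem Smooth.of_equiv {μ : m → m →ₗ[K] m} {μ' : m' → m' →ₗ[K] m'} (h : Smooth μ)
    (e : m' ≃ₗ[K] m) (he : ∀ z v, e (μ' z v) = μ (e z) (e v)) : Smooth μ' :=
  h.transport e.symm fun z v => by simp [LinearEquiv.symm_apply_eq, he]

theorem Smooth.of_quadratic_family [CharZero K] [Module.Finite K m] {μ μ₁ μ₂ : m → m →ₗ[K] m}
    (h : ∀ τ : K, τ ≠ 0 → Smooth fun z => μ z + τ • μ₁ z + τ ^ 2 • μ₂ z) : Smooth μ := by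
  intro N z
  refine EndClosure.of_quadratic_family
    (T₁ := fun i => (LinearMap.inr K K m).comp ((μ₁ (z i)).comp (LinearMap.snd K K m)))
    (T₂ := fun i => (LinearMap.inr K K m).comp ((μ₂ (z i)).comp (LinearMap.snd K K m)))
    fun τ hτ => ?_
  convert h τ hτ N z using 2 with i
  refine LinearMap.ext fun v => ?_
  simp [add_assoc]

theorem Smooth.prod_pi [Module.Finite K m] {κ : Type*} [Fintype κ] {μ : m → m →ₗ[K] m}
    (h : Smooth μ) :
    Smooth fun z : m × (κ → K) => (μ z.1).prodMap (LinearMap.mulLeft K z.2) := by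
  intro N z
  let e : ((K × m) × (κ → K)) ≃ₗ[K] (K × (m × (κ → K))) :=
    { toFun := fun v => (v.1.1, (v.1.2, v.2 - fun _ => v.1.1))
      invFun := fun v => ((v.1, v.2.1), v.2.2 + fun _ => v.1)
      map_add' := fun v w => by
        ext <;> simp
        ring
      map_smul' := fun c v => by
        ext <;> simp
        ring
      left_inv := fun v => by simp
      right_inv := fun v => by simp }
  refine ((h N fun i => (z i).1).prodMap_mulLeft fun i => (z i).2).transport e fun i v => ?_
  ext k <;> simp [e]
  ring

theorem Smooth.of_subsingleton [Subsingleton m] (μ : m → m →ₗ[K] m) : Smooth μ := by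
  intro N z ι _ _ b
  have : (fun i => LinearMap.toMatrix b b (unitMul μ (z i))) = fun _ => 0 := by
    funext i
    have : unitMul μ (z i) = 0 := by
      refine LinearMap.ext fun v => ?_
      rw [unitMul_apply, Subsingleton.elim (v.1 • z i + μ (z i) v.2) 0]
      rfl
    rw [this, map_zero]
  rw [this]
  refine InSimDiagClosure.of_simDiag ⟨1, isUnit_one, fun i => ?_⟩
  simp [Matrix.IsDiag, Pairwise]

/-- Adjoining variables whose squares are prescribed annihilators of `m`, and whose other products
vanish. -/
def adjoin {κ : Type*} [Fintype κ] (μ : m → m →ₗ[K] m) (r : κ → m) (z : m × (κ → K)) :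
    m × (κ → K) →ₗ[K] m × (κ → K) :=
  (LinearMap.inl K m (κ → K)).comp
    ((μ z.1).coprod (∑ k, z.2 k • (LinearMap.toSpanSingleton K m (r k)).comp (LinearMap.proj k)))

@[simp]
theorem adjoin_apply {κ : Type*} [Fintype κ] (μ : m → m →ₗ[K] m) (r : κ → m) (z v : m × (κ → K)) :
    adjoin μ r z v = (μ z.1 v.1 + ∑ k, z.2 k • v.2 k • r k, 0) := by
  simp [adjoin]

theorem Smooth.adjoin [CharZero K] [Module.Finite K m] {κ : Type*} [Fintype κ]
    {μ : m → m →ₗ[K] m} (h : Smooth μ) (hadd : ∀ z z', μ (z + z') = μ z + μ z')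
    (hsmul : ∀ (c : K) z, μ (c • z) = c • μ z) (r : κ → m) (hr : ∀ k v, μ (r k) v = 0)
    (hr' : ∀ k v, μ v (r k) = 0) : Smooth (adjoin μ r) := by
  refine Smooth.of_quadratic_family
    (μ₁ := fun z => (LinearMap.inr K m (κ → K)).comp
      ((LinearMap.mulLeft K z.2).comp (LinearMap.snd K m (κ → K)))) (μ₂ := fun _ => 0)
    fun τ hτ => ?_
  let R : (κ → K) →ₗ[K] m := τ⁻¹ • Fintype.linearCombination K r
  have hR : ∀ a, R a = τ⁻¹ • ∑ k, a k • r k := fun a => by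
    simp [R, Fintype.linearCombination_apply]
  have hμ : ∀ (s : Finset κ) (f : κ → m), μ (∑ k ∈ s, f k) = ∑ k ∈ s, μ (f k) := fun s f =>
    map_sum (AddMonoidHom.mk' μ hadd) f s
  have hR1 : ∀ a v, μ (R a) v = 0 := fun a v => by
    simp [hR, hsmul, hμ, hr]
  have hR2 : ∀ a v, μ v (R a) = 0 := fun a v => by
    simp [hR, hr']
  let e : (m × (κ → K)) ≃ₗ[K] (m × (κ → K)) :=
    { toFun := fun v => (v.1 + R (τ⁻¹ • v.2), τ⁻¹ • v.2)
      invFun := fun v => (v.1 - R v.2, τ • v.2)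
      map_add' := fun v w => by
        ext <;> simp
        · abel
        · ring
      map_smul' := fun c v => by
        refine Prod.ext ?_ (smul_comm _ _ _)
        simp only [Prod.smul_fst, Prod.smul_snd, smul_comm τ⁻¹ c, map_smul, smul_add,
          RingHom.id_apply]
      left_inv := fun v => by simp [smul_smul, hτ]
      right_inv := fun v => by simp [smul_smul, hτ] }
  refine h.prod_pi.transport e fun z v => ?_
  have h1 : μ (z.1 + R (τ⁻¹ • z.2)) (v.1 + R (τ⁻¹ • v.2)) = μ z.1 v.1 := by
    rw [hadd, LinearMap.add_apply, hR1, map_add, hR2, add_zero, add_zero]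
  refine Prod.ext ?_ ?_
  · simp only [e, LinearEquiv.coe_mk, LinearMap.coe_mk, AddHom.coe_mk, LinearMap.prodMap_apply,
      LinearMap.add_apply, adjoin_apply, LinearMap.smul_apply, LinearMap.comp_apply, Prod.fst_add,
      Prod.smul_fst, LinearMap.inr_apply, smul_zero, add_zero, h1]
    simp [hR, Finset.smul_sum, smul_smul]
    refine Finset.sum_congr rfl fun k _ => ?_
    congr 1
    ring
  · ext k
    simp [e]
    field_simp

end Smooth

section NormalForm

variable {K : Type*} [Field K] {X : Type*} [AddCommGroup X] [Module K X]

theorem Smooth.zero [CharZero K] [Module.Finite K X] : Smooth fun _ : X => (0 : X →ₗ[K] X) := by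
  refine (Smooth.adjoin (Smooth.of_subsingleton fun _ : PUnit => (0 : PUnit →ₗ[K] PUnit))
    (by simp) (by simp) (fun _ : Fin (finrank K X) => 0) (by simp) (by simp)).transport
    (LinearEquiv.uniqueProd.trans (Module.finBasis K X).equivFun.symm) fun z v => ?_
  simp

/-- The algebra `X × K` with multiplication given by a bilinear form. -/
def formMul (G : LinearMap.BilinForm K X) (z : X × K) : X × K →ₗ[K] X × K :=
  (LinearMap.inr K X K).comp ((G z.1).comp (LinearMap.fst K X K))

@[simp]
theorem formMul_apply (G : LinearMap.BilinForm K X) (z v : X × K) :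
    formMul G z v = (0, G z.1 v.1) := by
  simp [formMul]

theorem Smooth.formMul [CharZero K] [Module.Finite K X] (G : LinearMap.BilinForm K X)
    (hG : ∀ x y, G x y = G y x) : Smooth (formMul G) := by
  have : Invertible (2 : K) := invertibleOfNonzero two_ne_zero
  obtain ⟨v, hv⟩ := LinearMap.BilinForm.exists_orthogonal_basis (B := G) ⟨hG⟩
  refine (Smooth.adjoin (Smooth.zero (K := K) (X := K)) (by simp) (by simp)
    (fun j => G (v j) (v j)) (by simp) (by simp)).transport
    ((LinearEquiv.prodComm K K _).trans (v.equivFun.symm.prodCongr (LinearEquiv.refl K K)))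
    fun z w => ?_
  have : G (v.equivFun.symm z.2) (v.equivFun.symm w.2) =
      ∑ j, z.2 j * (w.2 j * G (v j) (v j)) := by
    simp only [Basis.equivFun_symm_apply, map_sum, LinearMap.sum_apply, map_smul,
      LinearMap.smul_apply, smul_eq_mul]
    refine Finset.sum_congr rfl fun j _ => ?_
    rw [Finset.sum_eq_single j]
    · ring
    · intro k _ hk
      have := LinearMap.isOrthoᵢ_def.1 hv k j hk
      simp [this]
    · simp
  simp only [LinearEquiv.trans_apply, LinearEquiv.prodCongr_apply, formMul_apply, this,
    LinearEquiv.prodComm_apply, adjoin_apply, Prod.swap]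
  simp

/-- The multiplication on `X × (ι → K) × K` whose values on `X × X` are the products of
coordinates under linear forms `ℓ i`, and which pairs the coordinates with `X` through `ℓ i`. -/
def diagMul {ι : Type*} [Fintype ι] (ℓ : ι → X →ₗ[K] K) (z : X × (ι → K) × K) :
    X × (ι → K) × K →ₗ[K] X × (ι → K) × K where
  toFun v := (0, fun i => ℓ i z.1 * ℓ i v.1, ∑ i, (z.2.1 i * ℓ i v.1 + v.2.1 i * ℓ i z.1))
  map_add' v w := by
    ext i
    · simp
    · simp [mul_add]
    · simp only [Prod.fst_add, Prod.snd_add, map_add, Pi.add_apply, ← Finset.sum_add_distrib]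
      exact Finset.sum_congr rfl fun i _ => by ring
  map_smul' c v := by
    ext i
    · simp
    · simp
      ring
    · simp only [Prod.smul_fst, Prod.smul_snd, map_smul, Pi.smul_apply, smul_eq_mul,
        RingHom.id_apply, Finset.mul_sum]
      exact Finset.sum_congr rfl fun i _ => by ring

theorem diagMul_apply {ι : Type*} [Fintype ι] (ℓ : ι → X →ₗ[K] K) (z v : X × (ι → K) × K) :
    diagMul ℓ z v =
      (0, fun i => ℓ i z.1 * ℓ i v.1, ∑ i, (z.2.1 i * ℓ i v.1 + v.2.1 i * ℓ i z.1)) :=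
  rfl

theorem diagMul_comm {ι : Type*} [Fintype ι] (ℓ : ι → X →ₗ[K] K) (z v : X × (ι → K) × K) :
    diagMul ℓ z v = diagMul ℓ v z := by
  simp only [diagMul_apply, mul_comm, add_comm]

theorem Smooth.diagMul [CharZero K] [Module.Finite K X] {ι : Type*} [Fintype ι]
    (ℓ : ι → X →ₗ[K] K) : Smooth (diagMul ℓ) := by
  let μ₁ (z : X × (ι → K) × K) : X × (ι → K) × K →ₗ[K] X × (ι → K) × K :=
    { toFun := fun v => (0, fun i => ℓ i z.1 * v.2.1 i + ℓ i v.1 * z.2.1 i, ∑ i, z.2.1 i * v.2.1 i)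
      map_add' := fun v w => by
        ext i
        · simp
        · simp
          ring
        · simp [mul_add, Finset.sum_add_distrib]
      map_smul' := fun c v => by
        ext i
        · simp
        · simp
          ring
        · simp [mul_left_comm, Finset.mul_sum] }
  let μ₂ (z : X × (ι → K) × K) : X × (ι → K) × K →ₗ[K] X × (ι → K) × K :=
    { toFun := fun v => (0, z.2.1 * v.2.1, 0)
      map_add' := fun v w => by simp [mul_add]
      map_smul' := fun c v => by simp }
  refine Smooth.of_quadratic_family (μ₁ := μ₁) (μ₂ := μ₂) fun τ hτ => ?_
  let G : LinearMap.BilinForm K X := ∑ i, LinearMap.BilinForm.linMulLin (-τ⁻¹ • ℓ i) (ℓ i)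
  have hG : ∀ x y, G x y = -τ⁻¹ * ∑ i, ℓ i x * ℓ i y := fun x y => by
    simp [G, LinearMap.sum_apply, LinearMap.BilinForm.linMulLin_apply, Finset.mul_sum, mul_assoc]
  let e : (X × (ι → K) × K) ≃ₗ[K] ((X × K) × (ι → K)) :=
    { toFun := fun v => ((v.1, v.2.2 - τ⁻¹ * ∑ i, v.2.1 i),
        fun i => τ * ℓ i v.1 + τ ^ 2 * v.2.1 i)
      invFun := fun v => (v.1.1, fun i => (τ ^ 2)⁻¹ * (v.2 i - τ * ℓ i v.1.1),
        v.1.2 + τ⁻¹ * ∑ i, (τ ^ 2)⁻¹ * (v.2 i - τ * ℓ i v.1.1))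
      map_add' := fun v w => by
        ext i
        · simp
        · simp [Finset.sum_add_distrib]
          ring
        · simp
          ring
      map_smul' := fun c v => by
        ext i
        · simp
        · simp [← Finset.mul_sum]
          ring
        · simp
          ring
      left_inv := fun v => by
        have (i : ι) : (τ ^ 2)⁻¹ * (τ * ℓ i v.1 + τ ^ 2 * v.2.1 i - τ * ℓ i v.1) = v.2.1 i := by
          field_simp
          ring
        simp only [this]
        simp
      right_inv := fun v => by
        have (i : ι) : τ * ℓ i v.1.1 + τ ^ 2 * ((τ ^ 2)⁻¹ * (v.2 i - τ * ℓ i v.1.1)) = v.2 i := by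
          field_simp
          ring
        simp only [this]
        simp }
  refine (Smooth.formMul G fun x y => ?_).prod_pi.of_equiv e fun z v => ?_
  · simp only [hG, mul_comm]
  · ext i
    · simp [e, _root_.diagMul, μ₁, μ₂]
    · simp only [e, _root_.diagMul, μ₁, μ₂, LinearEquiv.coe_mk, LinearMap.coe_mk, AddHom.coe_mk,
        LinearMap.prodMap_apply, formMul_apply, hG, LinearMap.add_apply, LinearMap.smul_apply,
        Prod.fst_add, Prod.snd_add, Prod.smul_fst, Prod.smul_snd, Pi.add_apply, Pi.smul_apply,
        smul_eq_mul, Pi.mul_apply, mul_zero, add_zero, Finset.mul_sum, ← Finset.sum_add_distrib,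
        ← Finset.sum_sub_distrib]
      refine Finset.sum_congr rfl fun i _ => ?_
      field_simp
      ring
    · simp [e, _root_.diagMul, μ₁, μ₂]
      ring

end NormalForm

section Dominant

variable {K : Type*} [Field K] {α β : Type*}

theorem derivation_aeval [Fintype β] (D : Derivation K (MvPolynomial α K) (MvPolynomial α K))
    (φ : β → MvPolynomial α K) (P : MvPolynomial β K) :
    D (MvPolynomial.aeval φ P) =
      ∑ b, MvPolynomial.aeval φ (MvPolynomial.pderiv b P) * D (φ b) := by
  classical
  induction P using MvPolynomial.induction_on with
  | C a => simp [MvPolynomial.algebraMap_eq]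
  | add p q hp hq =>
    rw [map_add, map_add, hp, hq, ← Finset.sum_add_distrib]
    exact Finset.sum_congr rfl fun b _ => by rw [map_add, map_add, add_mul]
  | mul_X p i hp =>
    have (b : β) : MvPolynomial.aeval φ (MvPolynomial.pderiv b (p * MvPolynomial.X i)) * D (φ b) =
        φ i * (MvPolynomial.aeval φ (MvPolynomial.pderiv b p) * D (φ b)) +
          if i = b then MvPolynomial.aeval φ p * D (φ i) else 0 := by
      rw [Derivation.leibniz, MvPolynomial.pderiv_X]
      split_ifs with h
      · subst h
        simp only [Pi.single_eq_same, smul_eq_mul, map_add, map_mul, map_one, MvPolynomial.aeval_X]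
        ring
      · simp only [Pi.single_eq_of_ne h, smul_eq_mul, map_add, map_mul, map_zero,
          MvPolynomial.aeval_X]
        ring
    simp only [this, Finset.sum_add_distrib, ← Finset.mul_sum, ← hp]
    rw [map_mul, MvPolynomial.aeval_X, Derivation.leibniz]
    simp [add_comm]

theorem eq_C_of_pderiv_eq_zero [CharZero K] (P : MvPolynomial β K)
    (h : ∀ b, MvPolynomial.pderiv b P = 0) : P = MvPolynomial.C (P.coeff 0) := by
  classical
  ext m
  rw [MvPolynomial.coeff_C]
  split_ifs with hm
  · rw [hm]
  · obtain ⟨b, hb⟩ : ∃ b, m b ≠ 0 := by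
      by_contra! h0
      exact hm (Finsupp.ext fun b => (h0 b).symm)
    have := MvPolynomial.coeff_pderiv (i := b) P (m - Finsupp.single b 1)
    rw [h b, MvPolynomial.coeff_zero, tsub_add_cancel_of_le
      (Finsupp.single_le_iff.2 (Nat.one_le_iff_ne_zero.2 hb))] at this
    exact (mul_eq_zero.1 this.symm).resolve_right (Nat.cast_add_one_ne_zero _)

theorem aeval_eq_zero_of_derivative [CharZero K] [Fintype β] [DecidableEq β]
    (φ : β → MvPolynomial α K) (y : α → K) (u : β → α → K)
    (hu : ∀ b b', MvPolynomial.eval y (MvPolynomial.mkDerivation K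
      (fun a => MvPolynomial.C (u b a)) (φ b')) = if b = b' then 1 else 0)
    (P : MvPolynomial β K) (hP : MvPolynomial.aeval φ P = 0) : P = 0 := by
  induction hn : P.totalDegree using Nat.strong_induction_on generalizing P with
  | _ n ih =>
  let M : Matrix β β (MvPolynomial α K) := Matrix.of fun b b' =>
    MvPolynomial.mkDerivation K (fun a => MvPolynomial.C (u b a)) (φ b')
  have hM : M.det ≠ 0 := by
    intro h0
    have h1 := RingHom.map_det (MvPolynomial.eval y) M
    have h2 : (MvPolynomial.eval y).mapMatrix M = 1 := by
      ext b b'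
      simp [M, hu, Matrix.one_apply]
    rw [h2, h0] at h1
    simp at h1
  have h3 : M *ᵥ (fun b => MvPolynomial.aeval φ (MvPolynomial.pderiv b P)) = 0 := by
    funext b
    have := derivation_aeval (MvPolynomial.mkDerivation K
      (fun a => MvPolynomial.C (u b a))) φ P
    rw [hP, map_zero] at this
    simp only [Matrix.mulVec, dotProduct, M, Matrix.of_apply, Pi.zero_apply]
    rw [this]
    exact Finset.sum_congr rfl fun _ _ => mul_comm _ _
  have h4 := Matrix.eq_zero_of_mulVec_eq_zero hM h3
  have h5 : ∀ b, MvPolynomial.pderiv b P = 0 := by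
    intro b
    by_contra hb
    refine hb (ih _ ?_ _ (congrFun h4 b) rfl)
    obtain ⟨m, hm, hm'⟩ : ∃ m ∈ (MvPolynomial.pderiv b P).support,
        (MvPolynomial.pderiv b P).totalDegree = m.sum fun _ e => e :=
      Finset.exists_mem_eq_sup _ (MvPolynomial.support_nonempty.2 hb) _
    rw [MvPolynomial.mem_support_iff, MvPolynomial.coeff_pderiv] at hm
    have := MvPolynomial.le_totalDegree (MvPolynomial.mem_support_iff.2 (left_ne_zero_of_mul hm))
    rw [Finsupp.sum_add_index' (by simp) (by simp), Finsupp.sum_single_index rfl] at this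
    lia
  have h6 := eq_C_of_pderiv_eq_zero P h5
  rw [h6, MvPolynomial.aeval_C, MvPolynomial.algebraMap_eq, MvPolynomial.C_eq_zero] at hP
  rw [h6, hP, map_zero]

/-- A polynomial vanishing on a dense part of the image of a polynomial map into a subspace `S`
vanishes on `S` when the map is submersive onto `S` at one point. -/
theorem eval_eq_zero_of_dominant [CharZero K] [Finite β] (S : Submodule K (β → K))
    (φ : β → MvPolynomial α K) (hφ : ∀ y, (fun b => MvPolynomial.eval y (φ b)) ∈ S) (y₀ : α → K)
    (hs : ∀ v ∈ S, ∃ u : α → K, ∀ b, MvPolynomial.eval y₀ (MvPolynomial.mkDerivation K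
      (fun a => MvPolynomial.C (u a)) (φ b)) = v b)
    (g : MvPolynomial α K) (hg : MvPolynomial.eval y₀ g ≠ 0) (P : MvPolynomial β K)
    (h : ∀ y, MvPolynomial.eval y g ≠ 0 →
      MvPolynomial.eval (fun b => MvPolynomial.eval y (φ b)) P = 0) :
    ∀ v ∈ S, MvPolynomial.eval v P = 0 := by
  classical
  have := Fintype.ofFinite β
  let s := Module.finBasis K S
  obtain ⟨p, hp⟩ := LinearMap.exists_leftInverse_of_injective S.subtype S.ker_subtype
  let L : (β → K) →ₗ[K] (Fin (finrank K S) → K) := s.equivFun.toLinearMap.comp p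
  have hL (v : β → K) (hv : v ∈ S) (b : β) : ∑ j, (s j).1 b * L v j = v b := by
    have h1 : p v = ⟨v, hv⟩ := LinearMap.congr_fun hp ⟨v, hv⟩
    have h2 : (∑ j, s.equivFun ⟨v, hv⟩ j • s j : S).1 b = v b := by rw [s.sum_equivFun]
    rw [← h2, Submodule.coe_sum, Finset.sum_apply]
    simp [L, h1, mul_comm]
  have hLe (v : β → K) (j) : L v j = ∑ b, L (Pi.single b 1) j * v b := by
    have h1 := congrArg (fun w => L w j) (pi_eq_sum_univ' v)
    simpa [mul_comm] using h1
  let P' := MvPolynomial.aeval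
    (fun b => ∑ j, MvPolynomial.C ((s j).1 b) * (MvPolynomial.X j : MvPolynomial _ K)) P
  have hP' (c) : MvPolynomial.eval c P' =
      MvPolynomial.eval (fun b => ∑ j, (s j).1 b * c j) P := by
    simp only [P', eval_aeval, map_sum, map_mul, MvPolynomial.eval_C, MvPolynomial.eval_X]
  let φ' (j : Fin (finrank K S)) := ∑ b, MvPolynomial.C (L (Pi.single b 1) j) * φ b
  have hφ' (y) : (fun j => MvPolynomial.eval y (φ' j)) =
      L fun b => MvPolynomial.eval y (φ b) := by
    funext j
    rw [hLe]
    simp only [φ', map_sum, map_mul, MvPolynomial.eval_C]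
  have h0 : MvPolynomial.aeval φ' P' * g = 0 := by
    refine MvPolynomial.funext fun y => ?_
    rw [map_mul, map_zero, eval_aeval, hφ', hP']
    simp only [hL _ (hφ y)]
    by_cases hy : MvPolynomial.eval y g = 0
    · rw [hy, mul_zero]
    · rw [h y hy, zero_mul]
  have hg0 : g ≠ 0 := fun h => hg (by rw [h, map_zero])
  have hex (j : Fin (finrank K S)) := hs (s j) (s j).2
  choose u hu using hex
  have hz : P' = 0 := by
    refine aeval_eq_zero_of_derivative φ' y₀ u (fun j j' => ?_) P'
      ((mul_eq_zero.1 h0).resolve_right hg0)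
    have h1 : p (s j).1 = s j := LinearMap.congr_fun hp (s j)
    have h2 : L (s j).1 j' = if j = j' then 1 else 0 := by
      simp [L, h1]
    rw [← h2, hLe]
    simp only [φ', map_sum, Derivation.leibniz, MvPolynomial.derivation_C, smul_eq_mul, mul_zero,
      add_zero, map_mul, MvPolynomial.eval_C, hu]
  intro v hv
  have := hP' (L v)
  rw [hz, map_zero] at this
  simpa only [hL v hv] using this.symm

theorem Smooth.of_dominant [CharZero K] [Finite β] {m : Type*} [AddCommGroup m] [Module K m]
    [Module.Finite K m] (μ : (β → K) → m → m →ₗ[K] m)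
    (hμ : ∀ (c : K) π π' z v, μ (c • π + π') z v = c • (μ π z v - μ 0 z v) + μ π' z v)
    (S : Submodule K (β → K))
    (φ : β → MvPolynomial α K) (hφ : ∀ y, (fun b => MvPolynomial.eval y (φ b)) ∈ S) (y₀ : α → K)
    (hs : ∀ v ∈ S, ∃ u : α → K, ∀ b, MvPolynomial.eval y₀ (MvPolynomial.mkDerivation K
      (fun a => MvPolynomial.C (u a)) (φ b)) = v b)
    (g : MvPolynomial α K) (hg : MvPolynomial.eval y₀ g ≠ 0)
    (h : ∀ y, MvPolynomial.eval y g ≠ 0 → Smooth (μ fun b => MvPolynomial.eval y (φ b))) :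
    ∀ v ∈ S, Smooth (μ v) := by
  classical
  have := Fintype.ofFinite β
  intro v hv N z ι _ _ b Φ hΦ
  have hμ' (π : β → K) (z w) :
      μ π z w = μ 0 z w + ∑ k, π k • (μ (Pi.single k 1) z w - μ 0 z w) := by
    have key (s : Finset β) : μ (∑ k ∈ s, π k • Pi.single k 1) z w =
        μ 0 z w + ∑ k ∈ s, π k • (μ (Pi.single k 1) z w - μ 0 z w) := by
      induction s using Finset.induction_on with
      | empty => simp
      | insert k s hk ih =>
        rw [Finset.sum_insert hk, Finset.sum_insert hk, hμ, ih]
        abel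
    rw [← key]
    congr 3
    simpa using pi_eq_sum_univ' π
  let E (π : β → K) (x : N × ι × ι) : K :=
    LinearMap.toMatrix b b (unitMul (μ π) (z x.1)) x.2.1 x.2.2
  have hE (π x) : E π x = E 0 x + ∑ k, π k * (E (Pi.single k 1) x - E 0 x) := by
    simp only [E, LinearMap.toMatrix_apply, unitMul_apply]
    rw [hμ' π]
    have : ((0 : K), (b x.2.2).1 • z x.1 + (μ 0 (z x.1) (b x.2.2).2 +
        ∑ k, π k • (μ (Pi.single k 1) (z x.1) (b x.2.2).2 - μ 0 (z x.1) (b x.2.2).2))) =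
        ((0 : K), (b x.2.2).1 • z x.1 + μ 0 (z x.1) (b x.2.2).2) +
        ∑ k, π k • (((0 : K), (b x.2.2).1 • z x.1 + μ (Pi.single k 1) (z x.1) (b x.2.2).2) -
          ((0 : K), (b x.2.2).1 • z x.1 + μ 0 (z x.1) (b x.2.2).2)) := by
      refine Prod.ext ?_ ?_
      · simp [Prod.fst_sum]
      · simp [Prod.snd_sum, add_assoc]
    rw [this]
    simp only [map_add, map_sum, map_smul, map_sub, Finsupp.add_apply, Finsupp.finsetSum_apply,
      Finsupp.smul_apply, Finsupp.sub_apply, smul_eq_mul]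
  let P := MvPolynomial.aeval (fun x => MvPolynomial.C (E 0 x) +
    ∑ k, MvPolynomial.X k * MvPolynomial.C (E (Pi.single k 1) x - E 0 x)) Φ
  have hP (π) : MvPolynomial.eval π P = MvPolynomial.eval (E π) Φ := by
    simp only [P, eval_aeval, map_add, map_sum, map_mul, MvPolynomial.eval_C, MvPolynomial.eval_X,
      ← hE]
  have := eval_eq_zero_of_dominant S φ hφ y₀ hs g hg P (fun y hy => ?_) v hv
  · rw [hP] at this
    exact this
  · rw [hP]
    exact h y hy N z ι b Φ hΦ

end Dominant

section ExtMul

variable {K : Type*} [Field K] {X W X' W' : Type*} [AddCommGroup X] [Module K X]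
  [AddCommGroup W] [Module K W] [AddCommGroup X'] [Module K X'] [AddCommGroup W'] [Module K W']

/-- The multiplication on `X × W × K` given by bilinear maps `X × X → W`, `X × X → K` and a
pairing of `X` with `W`. -/
def extMul (B : X →ₗ[K] X →ₗ[K] W) (C : LinearMap.BilinForm K X) (p : X →ₗ[K] W →ₗ[K] K)
    (z : X × W × K) : X × W × K →ₗ[K] X × W × K where
  toFun v := (0, B z.1 v.1, C z.1 v.1 + (p z.1 v.2.1 + p v.1 z.2.1))
  map_add' v w := by
    ext
    · simp
    · simp
    · simp
      ring
  map_smul' c v := by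
    ext
    · simp
    · simp
    · simp
      ring

theorem extMul_apply (B : X →ₗ[K] X →ₗ[K] W) (C : LinearMap.BilinForm K X)
    (p : X →ₗ[K] W →ₗ[K] K) (z v : X × W × K) :
    extMul B C p z v = (0, B z.1 v.1, C z.1 v.1 + (p z.1 v.2.1 + p v.1 z.2.1)) :=
  rfl

theorem Smooth.extMul_congr {B : X →ₗ[K] X →ₗ[K] W} {C : LinearMap.BilinForm K X}
    {p : X →ₗ[K] W →ₗ[K] K} {B' : X' →ₗ[K] X' →ₗ[K] W'} {C' : LinearMap.BilinForm K X'}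
    {p' : X' →ₗ[K] W' →ₗ[K] K} (h : Smooth (extMul B C p)) (eX : X' ≃ₗ[K] X) (eW : W' ≃ₗ[K] W)
    (hB : ∀ x y, eW (B' x y) = B (eX x) (eX y)) (hC : ∀ x y, C' x y = C (eX x) (eX y))
    (hp : ∀ x w, p' x w = p (eX x) (eW w)) : Smooth (extMul B' C' p') :=
  h.of_equiv (eX.prodCongr (eW.prodCongr (LinearEquiv.refl K K))) fun z v => by
    simp [extMul_apply, hB, hC, hp]

end ExtMul

section Generic

variable {K : Type*} [Field K] [CharZero K] {s t : ℕ}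

theorem exists_polarization (C : LinearMap.BilinForm K (Fin s ⊕ Fin t → K))
    (hC : ∀ x y, C x y = C y x)
    (hCY : ∀ x y, (∀ j, x (Sum.inl j) = 0) → (∀ j, y (Sum.inl j) = 0) → C x y = 0) :
    ∃ a : (Fin s ⊕ Fin t → K) →ₗ[K] (Fin s → K),
      ∀ x y, C x y = ∑ j, (x (Sum.inl j) * a y j + y (Sum.inl j) * a x j) := by
  classical
  let σ : (Fin s ⊕ Fin t → K) →ₗ[K] (Fin s ⊕ Fin t → K) :=
    ∑ j, (LinearMap.single K (fun _ => K) (Sum.inl j)).comp (LinearMap.proj (Sum.inl j))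
  have hσ (x : Fin s ⊕ Fin t → K) : σ x = ∑ j : Fin s, x (Sum.inl j) • Pi.single (Sum.inl j) 1 := by
    simp [σ, LinearMap.sum_apply, ← Pi.single_smul']
  have hσj (x : Fin s ⊕ Fin t → K) (j : Fin s) : σ x (Sum.inl j) = x (Sum.inl j) := by
    simp [hσ, Pi.single_apply]
  let a : (Fin s ⊕ Fin t → K) →ₗ[K] (Fin s → K) := LinearMap.pi fun j =>
    C.flip (Pi.single (Sum.inl j) 1) - (2⁻¹ : K) • (C.flip (Pi.single (Sum.inl j) 1)).comp σ
  have key (x y : Fin s ⊕ Fin t → K) :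
      ∑ j, x (Sum.inl j) * a y j = C y (σ x) - 2⁻¹ * C (σ y) (σ x) := by
    rw [hσ x]
    simp only [a, LinearMap.pi_apply, LinearMap.sub_apply, LinearMap.BilinForm.flip_apply,
      LinearMap.smul_apply, LinearMap.comp_apply, map_sum, map_smul, smul_eq_mul, Finset.mul_sum,
      ← Finset.sum_sub_distrib]
    exact Finset.sum_congr rfl fun j _ => by ring
  refine ⟨a, fun x y => ?_⟩
  have h1 := hCY (x - σ x) (y - σ y) (by simp [hσj]) (by simp [hσj])
  simp only [map_sub, LinearMap.sub_apply] at h1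
  rw [Finset.sum_add_distrib, key, key, hC (σ y) (σ x), hC y (σ x)]
  linear_combination h1

theorem Smooth.extMul_of_diagonal (M : Matrix (Fin s ⊕ Unit) (Fin s ⊕ Unit) K) (hM : M.det ≠ 0)
    (h : Matrix (Fin t) (Fin s ⊕ Fin t) K) (hh : (h.submatrix id Sum.inr).det ≠ 0) (c : Fin t → K)
    (B : (Fin s ⊕ Fin t → K) →ₗ[K] (Fin s ⊕ Fin t → K) →ₗ[K] (Fin s ⊕ Unit → K))
    (C : LinearMap.BilinForm K (Fin s ⊕ Fin t → K)) (hC : ∀ x y, C x y = C y x)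
    (p : (Fin s ⊕ Fin t → K) →ₗ[K] (Fin s ⊕ Unit → K) →ₗ[K] K)
    (hB : ∀ x y, B x y = (fun i => (∑ j, M i (Sum.inl j) * x (Sum.inl j)) *
      (∑ j, M i (Sum.inl j) * y (Sum.inl j))) ᵥ* M +
      (∑ k, (h *ᵥ x) k * (h *ᵥ y) k) • Pi.single (Sum.inr ()) 1)
    (hCY : ∀ x y, (∀ j, x (Sum.inl j) = 0) → (∀ j, y (Sum.inl j) = 0) →
      C x y = ∑ k, c k * ((h *ᵥ x) k * (h *ᵥ y) k))
    (hp : ∀ x w, p x w = ∑ j, x (Sum.inl j) * w (Sum.inl j)) : Smooth (extMul B C p) := by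
  have hM' : IsUnit M.det := isUnit_iff_ne_zero.2 hM
  let H : LinearMap.BilinForm K (Fin s ⊕ Fin t → K) :=
    ∑ k, LinearMap.BilinForm.linMulLin (c k • (LinearMap.proj k).comp h.mulVecLin)
      ((LinearMap.proj k).comp h.mulVecLin)
  have hH (x y) : H x y = ∑ k, c k * ((h *ᵥ x) k * (h *ᵥ y) k) := by
    simp [H, LinearMap.sum_apply, LinearMap.BilinForm.linMulLin_apply, mul_assoc]
  obtain ⟨a, ha⟩ := exists_polarization (C - H) (fun x y => by
      simp only [LinearMap.sub_apply, hH, hC x y, mul_comm]) (fun x y hx hy => by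
      rw [LinearMap.sub_apply, LinearMap.sub_apply, hCY x y hx hy, hH, sub_self])
  let ℓ (i : Fin s ⊕ Unit) : (Fin s → K) →ₗ[K] K := ∑ j, M i (Sum.inl j) • LinearMap.proj j
  have hℓ (i x) : ℓ i x = ∑ j, M i (Sum.inl j) * x j := by
    simp [ℓ, LinearMap.sum_apply]
  have hsum (w : Fin s ⊕ Unit → K) (x : Fin s → K) :
      ∑ i, (w ᵥ* M⁻¹) i * ℓ i x = ∑ j, x j * w (Sum.inl j) := by
    have : (w ᵥ* M⁻¹) ᵥ* M = w := by rw [Matrix.vecMul_vecMul, Matrix.nonsing_inv_mul _ hM',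
      Matrix.vecMul_one]
    have h2 (j : Fin s) : w (Sum.inl j) = ∑ i, (w ᵥ* M⁻¹) i * M i (Sum.inl j) :=
      (congrFun this (Sum.inl j)).symm
    simp only [h2, hℓ, Finset.mul_sum]
    rw [Finset.sum_comm]
    exact Finset.sum_congr rfl fun i _ => Finset.sum_congr rfl fun j _ => by ring
  let q : Fin s ⊕ Unit → K := Pi.single (Sum.inr ()) 1 ᵥ* M⁻¹
  have hq (x : Fin s → K) : ∑ i, q i * ℓ i x = 0 := by
    rw [hsum]
    simp
  let S : (Fin s ⊕ Fin t → K) →ₗ[K] (Fin s → K) := LinearMap.funLeft K K Sum.inl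
  have hS (x j) : S x j = x (Sum.inl j) := rfl
  let α : (Fin s ⊕ Fin t → K) →ₗ[K] (Fin s ⊕ Unit → K) :=
    (Matrix.vecMulLinear M⁻¹).comp
      (LinearMap.pi (Sum.elim (fun j => (LinearMap.proj j).comp a) fun _ => 0))
  have hα (x y) : ∑ i, α x i * ℓ i y = ∑ j, y j * a x j := by
    simp only [α, LinearMap.comp_apply, Matrix.vecMulLinear_apply, hsum]
    rfl
  let e₀ : ((Fin s ⊕ Fin t → K) × (Fin s ⊕ Unit → K) × K) →ₗ[K]
      ((Fin s → K) × (Fin s ⊕ Unit → K) × K) × (Fin t → K) :=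
    { toFun := fun v => ((S v.1, v.2.1 ᵥ* M⁻¹ + α v.1, v.2.2), h *ᵥ v.1)
      map_add' := fun v w => by
        simp only [Prod.fst_add, Prod.snd_add, map_add, Matrix.add_vecMul, Matrix.mulVec_add,
          Prod.mk_add_mk]
        congr 3
        abel
      map_smul' := fun r v => by
        simp only [Prod.smul_fst, Prod.smul_snd, map_smul, Matrix.smul_vecMul, Matrix.mulVec_smul,
          RingHom.id_apply, ← smul_add, Prod.smul_mk] }
  have he₀ : Function.Injective e₀ := by
    refine (injective_iff_map_eq_zero e₀).2 fun v hv => ?_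
    have h1 : ((S v.1, v.2.1 ᵥ* M⁻¹ + α v.1, v.2.2), h *ᵥ v.1) = 0 := hv
    simp only [Prod.mk_eq_zero] at h1
    obtain ⟨⟨h1, h2, h3⟩, h4⟩ := h1
    have h5 : (h.submatrix id Sum.inr) *ᵥ (fun k => v.1 (Sum.inr k)) = 0 := by
      rw [← h4]
      funext k
      have (j : Fin s) : v.1 (Sum.inl j) = 0 := congrFun h1 j
      simp [Matrix.mulVec, dotProduct, this]
    have h6 : v.1 = 0 := by
      funext j
      rcases j with j | k
      · exact congrFun h1 j
      · exact congrFun (Matrix.eq_zero_of_mulVec_eq_zero hh h5) k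
    rw [h6, map_zero, add_zero] at h2
    have h7 : v.2.1 = 0 := by
      have := congrArg (fun w => w ᵥ* M) h2
      simpa [Matrix.vecMul_vecMul, Matrix.nonsing_inv_mul _ hM'] using this
    exact Prod.ext h6 (Prod.ext h7 h3)
  let e := LinearMap.linearEquivOfInjective e₀ he₀ (by
    simp only [finrank_prod, finrank_fintype_fun_eq_card, Fintype.card_sum, Fintype.card_fin]
    ring)
  refine ((Smooth.diagMul ℓ).adjoin (fun z z' => ?_) (fun r z => ?_) (fun k => (0, q, c k))
    (fun k v => ?_) fun k v => ?_).of_equiv e fun z v => ?_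
  · exact LinearMap.ext fun v => by
      simp only [LinearMap.add_apply, diagMul_comm ℓ _ v, map_add]
  · exact LinearMap.ext fun v => by
      simp only [LinearMap.smul_apply, diagMul_comm ℓ _ v, map_smul]
  · rw [diagMul_apply]
    simp [hq]
    rfl
  · rw [diagMul_apply]
    simp [hq]
    rfl
  · have he (v) : e v = ((S v.1, v.2.1 ᵥ* M⁻¹ + α v.1, v.2.2), h *ᵥ v.1) := rfl
    rw [he, he, he, adjoin_apply, extMul_apply, diagMul_apply]
    refine Prod.ext (Prod.ext ?_ (Prod.ext ?_ ?_)) ?_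
    · simp [Prod.fst_sum]
    · simp only [hB, hℓ, hS, map_zero, add_zero, Matrix.add_vecMul, Matrix.vecMul_vecMul,
        Matrix.mul_nonsing_inv _ hM', Matrix.vecMul_one, Matrix.smul_vecMul, Prod.fst_add,
        Prod.snd_add, Prod.fst_sum, Prod.snd_sum, Prod.smul_fst, Prod.smul_snd]
      simp only [Finset.sum_smul, mul_smul, q]
    · have h1 := ha z.1 v.1
      simp only [LinearMap.sub_apply, hH] at h1
      simp only [Prod.snd_add, Prod.snd_sum, Prod.smul_snd, smul_eq_mul, Pi.add_apply, add_mul,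
        Finset.sum_add_distrib, hsum, hα, hp, hS]
      rw [Finset.sum_add_distrib] at h1
      simp only [mul_left_comm, mul_comm] at h1 ⊢
      linear_combination h1
    · simp

end Generic

section Submersion

variable {K : Type*} [Field K] [CharZero K]

set_option maxHeartbeats 1000000 in
/-- For `s ≤ 3` there is a set of `s + 1` weighted linear forms at which the map sending weighted
linear forms to the sum of their cubes and the weighted sum of their squares is a submersion. -/
theorem exists_submersive_matrix {s : ℕ} (hs : s ≤ 3) :
    ∃ M : Matrix (Fin s ⊕ Unit) (Fin s ⊕ Unit) K, M.det ≠ 0 ∧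
      ∀ F : Fin s ⊕ Unit → Fin s → Fin s → K, (∀ c a b, F c a b = F c b a) →
        (∀ c a b, F (Sum.inl c) a b = F (Sum.inl a) c b) →
        ∃ m : Matrix (Fin s ⊕ Unit) (Fin s ⊕ Unit) K, ∀ c a b,
          ∑ i, (m i c * M i (Sum.inl a) * M i (Sum.inl b) +
            M i c * (m i (Sum.inl a) * M i (Sum.inl b) + M i (Sum.inl a) * m i (Sum.inl b))) =
          F c a b := by
  obtain rfl | ⟨s, rfl⟩ : s = 0 ∨ ∃ s', s = s' + 1 := by
    cases s <;> simp
  · exact ⟨1, by simp, fun F _ _ => ⟨0, fun c a => a.elim0⟩⟩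
  refine ⟨Matrix.fromBlocks 1 (Matrix.of fun i _ => if i = 0 then 1 else 0)
    (Matrix.of fun _ _ => 1) 0, ?_, fun F h₁ h₂ => ?_⟩
  · rw [Matrix.det_fromBlocks_one₁₁, Matrix.det_unique]
    simp [Matrix.mul_apply]
  have h3 : (3 : K) ≠ 0 := three_ne_zero
  obtain rfl | rfl | rfl : s = 0 ∨ s = 1 ∨ s = 2 := by lia
  · refine ⟨Matrix.fromBlocks !![F (Sum.inl 0) 0 0 / 3]
      (Matrix.of fun _ _ => F (Sum.inr ()) 0 0 - 2 * (F (Sum.inl 0) 0 0 / 3)) 0 0, ?_⟩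
    rintro (c | c) a b <;> fin_cases c <;> fin_cases a <;> fin_cases b <;> simp <;> ring
  · refine ⟨Matrix.fromBlocks
      !![F (Sum.inl 0) 0 0 / 3, F (Sum.inl 0) 0 1; F (Sum.inl 0) 1 1, F (Sum.inl 1) 1 1 / 3]
      (Matrix.of fun i _ => ![F (Sum.inr ()) 0 0 - 2 * (F (Sum.inl 0) 0 0 / 3) -
          (F (Sum.inr ()) 0 1 - F (Sum.inl 0) 0 1),
        F (Sum.inr ()) 1 1 - (F (Sum.inr ()) 0 1 - F (Sum.inl 0) 0 1)] i) 0
      (Matrix.of fun _ _ => F (Sum.inr ()) 0 1 - F (Sum.inl 0) 0 1), ?_⟩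
    rintro (c | c) a b <;> fin_cases c <;> fin_cases a <;> fin_cases b <;>
      simp [Fin.sum_univ_two] <;> grind
  · obtain ⟨u, hu⟩ : ∃ u : K, 3 * u = F (Sum.inl 0) 0 1 + F (Sum.inl 0) 0 2 - F (Sum.inr ()) 0 1 -
        F (Sum.inr ()) 0 2 + 2 * F (Sum.inr ()) 1 2 - F (Sum.inl 0) 1 2 :=
      ⟨_, mul_div_cancel₀ _ h3⟩
    obtain ⟨v, hv⟩ : ∃ v : K, v = F (Sum.inl 0) 0 1 - 2 * u -
      (F (Sum.inr ()) 0 1 - F (Sum.inr ()) 1 2) := ⟨_, rfl⟩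
    obtain ⟨w, hw⟩ : ∃ w : K, w = F (Sum.inl 0) 0 2 - 2 * u -
      (F (Sum.inr ()) 0 2 - F (Sum.inr ()) 1 2) := ⟨_, rfl⟩
    obtain ⟨x, hx⟩ : ∃ x : Fin 3 → K, ∀ i, 3 * x i = F (Sum.inl i) i i - 3 * ![u, v, w] i :=
      ⟨_, fun i => mul_div_cancel₀ _ h3⟩
    have hx0 := hx 0
    have hx1 := hx 1
    have hx2 := hx 2
    simp only [Matrix.cons_val] at hx0 hx1 hx2
    refine ⟨Matrix.fromBlocks
      !![x 0, F (Sum.inl 0) 0 1 - 2 * u - v, F (Sum.inl 0) 0 2 - 2 * u - w;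
        F (Sum.inl 0) 1 1 - 2 * v - u, x 1, F (Sum.inl 1) 1 2 - 2 * v - w;
        F (Sum.inl 0) 2 2 - 2 * w - u, F (Sum.inl 1) 2 2 - 2 * w - v, x 2]
      (Matrix.of fun i _ => ![F (Sum.inr ()) 0 0 - 2 * x 0 - F (Sum.inr ()) 1 2,
        F (Sum.inr ()) 1 1 - F (Sum.inr ()) 1 2, F (Sum.inr ()) 2 2 - F (Sum.inr ()) 1 2] i)
      (Matrix.of fun _ i => ![u, v, w] i) (Matrix.of fun _ _ => F (Sum.inr ()) 1 2), ?_⟩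
    rintro (c | c) a b <;> fin_cases c <;> fin_cases a <;> fin_cases b <;>
      simp [Fin.sum_univ_three] <;> grind

end Submersion

section Core

variable {K : Type*} [Field K] {s t : ℕ}

/-- The cubic form coefficients, quadratic form coefficients and Gram coefficients attached to the
indeterminates `M`, `h`, `c` of `Smooth.extMul_of_diagonal`. -/
noncomputable def genericArray (K : Type*) [Field K] (s t : ℕ) :
    ((Fin s ⊕ Unit) × (Fin s ⊕ Fin t) × (Fin s ⊕ Fin t)) ⊕ (Fin t × Fin t) →
      MvPolynomial (((Fin s ⊕ Unit) × (Fin s ⊕ Unit)) ⊕ (Fin t × (Fin s ⊕ Fin t)) ⊕ Fin t) K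
  | Sum.inl (c, a, b) =>
    (∑ i, MvPolynomial.X (Sum.inl (i, c)) *
      (Sum.elim (fun j => MvPolynomial.X (Sum.inl (i, Sum.inl j))) (fun _ => 0) a *
        Sum.elim (fun j => MvPolynomial.X (Sum.inl (i, Sum.inl j))) (fun _ => 0) b)) +
      Sum.elim (fun _ => 0) (fun _ => ∑ k, MvPolynomial.X (Sum.inr (Sum.inl (k, a))) *
        MvPolynomial.X (Sum.inr (Sum.inl (k, b)))) c
  | Sum.inr (k, l) =>
    ∑ i, MvPolynomial.X (Sum.inr (Sum.inr i)) * (MvPolynomial.X (Sum.inr (Sum.inl (i, Sum.inr k))) *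
      MvPolynomial.X (Sum.inr (Sum.inl (i, Sum.inr l))))

/-- The symmetries of the arrays in the image of `genericArray`. -/
def symmArray (K : Type*) [Field K] (s t : ℕ) : Submodule K
    (((Fin s ⊕ Unit) × (Fin s ⊕ Fin t) × (Fin s ⊕ Fin t)) ⊕ (Fin t × Fin t) → K) where
  carrier := {π | (∀ c a b, π (Sum.inl (c, a, b)) = π (Sum.inl (c, b, a))) ∧
    (∀ c a b, π (Sum.inl (Sum.inl c, Sum.inl a, Sum.inl b)) =
      π (Sum.inl (Sum.inl a, Sum.inl c, Sum.inl b))) ∧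
    (∀ c a k, π (Sum.inl (Sum.inl c, a, Sum.inr k)) = 0) ∧
    ∀ k l, π (Sum.inr (k, l)) = π (Sum.inr (l, k))}
  zero_mem' := by simp
  add_mem' := by
    rintro π π' ⟨h1, h2, h3, h4⟩ ⟨h1', h2', h3', h4'⟩
    exact ⟨fun c a b => congrArg₂ (· + ·) (h1 c a b) (h1' c a b),
      fun c a b => congrArg₂ (· + ·) (h2 c a b) (h2' c a b), fun c a k => by simp [h3, h3'],
      fun k l => congrArg₂ (· + ·) (h4 k l) (h4' k l)⟩
  smul_mem' := by
    rintro r π ⟨h1, h2, h3, h4⟩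
    exact ⟨fun c a b => congrArg (r * ·) (h1 c a b), fun c a b => congrArg (r * ·) (h2 c a b),
      fun c a k => by simp [h3], fun k l => congrArg (r * ·) (h4 k l)⟩

theorem eval_genericArray_mem (y) :
    (fun b => MvPolynomial.eval y (genericArray K s t b)) ∈ symmArray K s t := by
  refine ⟨fun c a b => ?_, fun c a b => ?_, fun c a k => ?_, fun k l => ?_⟩
  · simp only [genericArray, mul_comm]
  · simp only [genericArray, Sum.elim_inl, mul_left_comm]
  · simp [genericArray]
  · simp only [genericArray, mul_comm]

theorem exists_submersive_point [CharZero K] (hs : s ≤ 3) :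
    ∃ y : ((Fin s ⊕ Unit) × (Fin s ⊕ Unit)) ⊕ (Fin t × (Fin s ⊕ Fin t)) ⊕ Fin t → K,
      (Matrix.of fun i c => y (Sum.inl (i, c))).det ≠ 0 ∧
      (Matrix.of fun k l => y (Sum.inr (Sum.inl (k, Sum.inr l)))).det ≠ 0 ∧
      ∀ v ∈ symmArray K s t, ∃ u : _ → K, ∀ b, MvPolynomial.eval y (MvPolynomial.mkDerivation K
        (fun a => MvPolynomial.C (u a)) (genericArray K s t b)) = v b := by
  obtain ⟨M, hM, hMF⟩ := exists_submersive_matrix (K := K) hs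
  let y : ((Fin s ⊕ Unit) × (Fin s ⊕ Unit)) ⊕ (Fin t × (Fin s ⊕ Fin t)) ⊕ Fin t → K :=
    Sum.elim (fun q => M q.1 q.2)
      (Sum.elim (fun q => Sum.elim (fun _ => 0) (Pi.single q.1 1) q.2) fun k => k)
  refine ⟨y, hM, ?_, ?_⟩
  · have : (Matrix.of fun k l => y (Sum.inr (Sum.inl (k, Sum.inr l)))) = 1 := by
      ext k l
      simp [y, Matrix.one_apply, Pi.single_apply, eq_comm]
    simp [this]
  rintro v ⟨h1, h2, h3, h4⟩
  obtain ⟨m, hm⟩ := hMF (fun c a b => v (Sum.inl (c, Sum.inl a, Sum.inl b)))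
    (fun c a b => h1 _ _ _) fun c a b => h2 _ _ _
  let H (k l : Fin t) : K := v (Sum.inl (Sum.inr (), Sum.inr k, Sum.inr l))
  let E (k l : Fin t) : K := v (Sum.inr (k, l))
  let η (k l : Fin t) : K := if k = l then H k k / 2 else (E k l - l * H k l) / (k - l)
  let u : ((Fin s ⊕ Unit) × (Fin s ⊕ Unit)) ⊕ (Fin t × (Fin s ⊕ Fin t)) ⊕ Fin t → K :=
    Sum.elim (fun q => m q.1 q.2) (Sum.elim
      (fun q => Sum.elim (fun a => v (Sum.inl (Sum.inr (), Sum.inl a, Sum.inr q.1))) (η q.1) q.2)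
      fun k => E k k - k * H k k)
  refine ⟨u, ?_⟩
  have hη (k l : Fin t) : η k l + η l k = H k l := by
    by_cases hkl : k = l
    · subst hkl
      simp [η]
    · have h5 : (k : K) - l ≠ 0 := by
        rw [sub_ne_zero]
        exact fun h => hkl (Fin.ext (Nat.cast_injective h))
      have h6 : (l : K) - k ≠ 0 := by rwa [← neg_sub, neg_ne_zero]
      have h7 : H l k = H k l := h1 _ _ _
      have h8 : E l k = E k l := h4 _ _
      simp only [η, if_neg hkl, if_neg (Ne.symm hkl), h7, h8]
      field_simp
      ring
  have hη' (k l : Fin t) (hkl : k ≠ l) : k * η k l + l * η l k = E k l := by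
    have h5 : (k : K) - l ≠ 0 := by
      rw [sub_ne_zero]
      exact fun h => hkl (Fin.ext (Nat.cast_injective h))
    have h6 : (l : K) - k ≠ 0 := by rwa [← neg_sub, neg_ne_zero]
    have h7 : H l k = H k l := h1 _ _ _
    have h8 : E l k = E k l := h4 _ _
    simp only [η, if_neg hkl, if_neg (Ne.symm hkl), h7, h8]
    field_simp
    ring
  rintro (⟨c, a | k, b | l⟩ | ⟨k, l⟩)
  · rw [← hm]
    rcases c with c | c <;>
    · simp only [genericArray, Sum.elim_inl, Sum.elim_inr, map_add, map_sum, map_mul,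
        Derivation.leibniz, MvPolynomial.mkDerivation_X, MvPolynomial.eval_X, MvPolynomial.eval_C,
        smul_eq_mul, y, u, zero_mul, add_zero, Finset.sum_const_zero]
      exact Finset.sum_congr rfl fun i _ => by ring
  · rcases c with c | c
    · simp [genericArray, h3]
    · simp [genericArray, y, u, Derivation.leibniz, MvPolynomial.mkDerivation_X, Pi.single_apply]
  · rcases c with c | c
    · rw [h1]
      simp [genericArray, h3]
    · rw [h1]
      simp [genericArray, y, u, Derivation.leibniz, MvPolynomial.mkDerivation_X, Pi.single_apply]
  · rcases c with c | c
    · simp [genericArray, h3]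
    · simp [genericArray, y, u, Derivation.leibniz, MvPolynomial.mkDerivation_X, Pi.single_apply,
        Finset.sum_add_distrib, hη]
      rfl
  · have key : v (Sum.inr (k, l)) =
        k * η k l + l * η l k + if k = l then E l l - l * H l l else 0 := by
      by_cases hkl : k = l
      · subst hkl
        rw [if_pos rfl]
        linear_combination -(k : K) * hη k k
      · rw [if_neg hkl, add_zero, hη' k l hkl]
    rw [key]
    simp [genericArray, y, u, Derivation.leibniz, MvPolynomial.mkDerivation_X, Pi.single_apply,
      Finset.sum_add_distrib, mul_add]

end Core

section ExtMulCore

variable {K : Type*} [Field K] {s t : ℕ}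

/-- The bilinear map `B` of an array of coefficients. -/
noncomputable def arrayBilin
    (π : ((Fin s ⊕ Unit) × (Fin s ⊕ Fin t) × (Fin s ⊕ Fin t)) ⊕ (Fin t × Fin t) → K) :
    (Fin s ⊕ Fin t → K) →ₗ[K] (Fin s ⊕ Fin t → K) →ₗ[K] (Fin s ⊕ Unit → K) :=
  LinearMap.mk₂ K (fun x y c => ∑ a, ∑ b, π (Sum.inl (c, a, b)) * (x a * y b))
    (fun x x' y => funext fun c => by
      simp only [Pi.add_apply, add_mul, mul_add, Finset.sum_add_distrib])
    (fun r x y => funext fun c => by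
      simp only [Pi.smul_apply, smul_eq_mul, Finset.mul_sum, mul_left_comm, mul_assoc])
    (fun x y y' => funext fun c => by
      simp only [Pi.add_apply, mul_add, Finset.sum_add_distrib])
    (fun r x y => funext fun c => by
      simp only [Pi.smul_apply, smul_eq_mul, Finset.mul_sum, mul_left_comm])

/-- The form on the last `t` coordinates of an array of coefficients. -/
noncomputable def arrayForm
    (π : ((Fin s ⊕ Unit) × (Fin s ⊕ Fin t) × (Fin s ⊕ Fin t)) ⊕ (Fin t × Fin t) → K) :
    LinearMap.BilinForm K (Fin s ⊕ Fin t → K) :=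
  LinearMap.mk₂ K (fun x y => ∑ k, ∑ l, π (Sum.inr (k, l)) * (x (Sum.inr k) * y (Sum.inr l)))
    (fun x x' y => by
      simp only [Pi.add_apply, add_mul, mul_add, Finset.sum_add_distrib])
    (fun r x y => by
      simp only [Pi.smul_apply, smul_eq_mul, Finset.mul_sum, mul_left_comm, mul_assoc])
    (fun x y y' => by
      simp only [Pi.add_apply, mul_add, Finset.sum_add_distrib])
    (fun r x y => by
      simp only [Pi.smul_apply, smul_eq_mul, Finset.mul_sum, mul_left_comm])

theorem arrayBilin_apply (π) (x y : Fin s ⊕ Fin t → K) (c) :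
    arrayBilin π x y c = ∑ a, ∑ b, π (Sum.inl (c, a, b)) * (x a * y b) :=
  rfl

theorem arrayForm_apply (π) (x y : Fin s ⊕ Fin t → K) :
    arrayForm π x y = ∑ k, ∑ l, π (Sum.inr (k, l)) * (x (Sum.inr k) * y (Sum.inr l)) :=
  rfl

theorem sum_sum_apply_single {ι M : Type*} [Fintype ι] [DecidableEq ι] [AddCommGroup M] [Module K M]
    (B : (ι → K) →ₗ[K] (ι → K) →ₗ[K] M) (x y : ι → K) :
    B x y = ∑ a, ∑ b, (x a * y b) • B (Pi.single a 1) (Pi.single b 1) := by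
  conv_lhs => rw [pi_eq_sum_univ' x, pi_eq_sum_univ' y]
  simp only [map_sum, map_smul, LinearMap.sum_apply, LinearMap.smul_apply, Finset.smul_sum,
    mul_smul]
  rw [Finset.sum_comm]
  simp only [smul_comm (y _)]

theorem sum_sum_gram {ι κ : Type*} [Fintype ι] [Fintype κ] (w : ι → K) (u : ι → κ → K)
    (x y : κ → K) : ∑ a, ∑ b, (∑ i, w i * (u i a * u i b)) * (x a * y b) =
      ∑ i, w i * ((∑ a, u i a * x a) * ∑ b, u i b * y b) := by
  simp_rw [Finset.sum_mul_sum, Finset.mul_sum, Finset.sum_mul]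
  refine ((Finset.sum_congr rfl fun a _ => Finset.sum_comm).trans Finset.sum_comm).trans ?_
  exact Finset.sum_congr rfl fun i _ => Finset.sum_congr rfl fun a _ =>
    Finset.sum_congr rfl fun b _ => by ring

theorem arrayBilin_genericArray (y) (x x' : Fin s ⊕ Fin t → K) :
    arrayBilin (fun b => MvPolynomial.eval y (genericArray K s t b)) x x' =
      (fun i => (∑ j, y (Sum.inl (i, Sum.inl j)) * x (Sum.inl j)) *
        ∑ j, y (Sum.inl (i, Sum.inl j)) * x' (Sum.inl j)) ᵥ*
        (Matrix.of fun i c => y (Sum.inl (i, c))) +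
      (∑ k, ((Matrix.of fun k a => y (Sum.inr (Sum.inl (k, a)))) *ᵥ x) k *
        ((Matrix.of fun k a => y (Sum.inr (Sum.inl (k, a)))) *ᵥ x') k) •
          Pi.single (Sum.inr ()) 1 := by
  have h3 (i) (x : Fin s ⊕ Fin t → K) :
      ∑ a, Sum.elim (fun j => y (Sum.inl (i, Sum.inl j))) (fun _ : Fin t => 0) a * x a =
        ∑ j, y (Sum.inl (i, Sum.inl j)) * x (Sum.inl j) := by
    simp
  have h4 (i : Fin s ⊕ Unit) (a : Fin s ⊕ Fin t) : MvPolynomial.eval y (Sum.elim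
      (fun j => MvPolynomial.X (Sum.inl (i, Sum.inl j))) (fun _ : Fin t => 0) a) =
      Sum.elim (fun j => y (Sum.inl (i, Sum.inl j))) (fun _ : Fin t => 0) a := by
    rcases a with a | a <;> simp
  funext c
  rw [arrayBilin_apply, Pi.add_apply, Pi.smul_apply]
  rcases c with c | c
  · simp only [genericArray, Sum.elim_inl, add_zero, map_sum, map_mul, h4, MvPolynomial.eval_X,
      sum_sum_gram, h3]
    rw [Pi.single_eq_of_ne (by simp), smul_zero, add_zero]
    exact Finset.sum_congr rfl fun i _ => mul_comm _ _
  · simp only [genericArray, Sum.elim_inr, map_add, map_sum, map_mul, h4, MvPolynomial.eval_X,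
      sum_sum_gram, h3, add_mul, Finset.sum_add_distrib]
    have := sum_sum_gram 1 (fun k a => y (Sum.inr (Sum.inl (k, a)))) x x'
    simp only [Pi.one_apply, one_mul] at this
    rw [this, Pi.single_eq_same, smul_eq_mul, mul_one]
    exact congrArg (· + _) (Finset.sum_congr rfl fun i _ => mul_comm _ _)

theorem Smooth.extMul_core [CharZero K] (hs : s ≤ 3)
    (B : (Fin s ⊕ Fin t → K) →ₗ[K] (Fin s ⊕ Fin t → K) →ₗ[K] (Fin s ⊕ Unit → K))
    (hB : ∀ x y, B x y = B y x)
    (C : LinearMap.BilinForm K (Fin s ⊕ Fin t → K)) (hC : ∀ x y, C x y = C y x)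
    (p : (Fin s ⊕ Fin t → K) →ₗ[K] (Fin s ⊕ Unit → K) →ₗ[K] K)
    (hp : ∀ x w, p x w = ∑ j, x (Sum.inl j) * w (Sum.inl j))
    (hpB : ∀ x y z, p x (B y z) = p y (B x z)) : Smooth (extMul B C p) := by
  obtain ⟨y₀, hy₁, hy₂, hy₃⟩ := exists_submersive_point (K := K) (s := s) (t := t) hs
  let π₀ : ((Fin s ⊕ Unit) × (Fin s ⊕ Fin t) × (Fin s ⊕ Fin t)) ⊕ (Fin t × Fin t) → K :=
    Sum.elim (fun q => B (Pi.single q.2.1 1) (Pi.single q.2.2 1) q.1)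
      fun q => C (Pi.single (Sum.inr q.1) 1) (Pi.single (Sum.inr q.2) 1)
  let g : MvPolynomial (((Fin s ⊕ Unit) × (Fin s ⊕ Unit)) ⊕ (Fin t × (Fin s ⊕ Fin t)) ⊕ Fin t) K :=
    (Matrix.of fun i c => MvPolynomial.X (Sum.inl (i, c))).det *
      (Matrix.of fun k l => MvPolynomial.X (Sum.inr (Sum.inl (k, Sum.inr l)))).det
  have hg (y) : MvPolynomial.eval y g = (Matrix.of fun i c => y (Sum.inl (i, c))).det *
      (Matrix.of fun k l => y (Sum.inr (Sum.inl (k, Sum.inr l)))).det := by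
    rw [map_mul, RingHom.map_det, RingHom.map_det]
    congr 2 <;>
    · ext
      simp
  have hpj (j : Fin s) (w) : p (Pi.single (Sum.inl j) 1) w = w (Sum.inl j) := by
    simp [hp, Pi.single_apply]
  have hpk (k : Fin t) (w) : p (Pi.single (Sum.inr k) 1) w = 0 := by
    simp [hp]
  have hπ₀ : π₀ ∈ symmArray K s t := by
    refine ⟨fun c a b => congrFun (hB _ _) c, fun c a b => ?_, fun c a k => ?_, fun k l => hC _ _⟩
    · simp only [π₀, Sum.elim_inl, ← hpj]
      exact hpB _ _ _
    · simp only [π₀, Sum.elim_inl, ← hpj]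
      rw [hB, hpB, hpk]
  have := Smooth.of_dominant (fun π => extMul (arrayBilin π) (C + (arrayForm π - arrayForm π₀)) p)
    (fun r π π' z v => ?_) (symmArray K s t) (genericArray K s t) eval_genericArray_mem y₀ hy₃ g
    (by rw [hg]; exact mul_ne_zero hy₁ hy₂) (fun y hy => ?_) π₀ hπ₀
  · have h1 : arrayBilin π₀ = B := by
      refine LinearMap.ext₂ fun x y => funext fun c => ?_
      rw [sum_sum_apply_single B x y, arrayBilin_apply]
      simp only [π₀, Sum.elim_inl, Finset.sum_apply, Pi.smul_apply, smul_eq_mul, mul_comm]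
    have h2 : C + (arrayForm π₀ - arrayForm π₀) = C := LinearMap.ext₂ fun x y => by simp
    rwa [h1, h2] at this
  · refine Prod.ext ?_ (Prod.ext (funext fun i => ?_) ?_)
    · simp [extMul_apply]
    · simp only [extMul_apply, arrayBilin_apply, Prod.snd_add, Prod.smul_snd, Prod.snd_sub,
        Prod.fst_add, Prod.smul_fst, Prod.fst_sub, Pi.add_apply, Pi.smul_apply, Pi.sub_apply,
        smul_eq_mul, Pi.zero_apply, zero_mul, Finset.sum_const_zero, sub_zero, add_mul,
        Finset.sum_add_distrib, Finset.mul_sum, mul_assoc]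
    · simp only [extMul_apply, arrayForm_apply, LinearMap.add_apply, LinearMap.sub_apply,
        Prod.snd_add, Prod.smul_snd, Prod.snd_sub, Pi.add_apply, Pi.smul_apply,
        smul_eq_mul, Pi.zero_apply, zero_mul, Finset.sum_const_zero, add_mul,
        Finset.sum_add_distrib, mul_assoc, ← Finset.mul_sum]
      ring
  · rw [hg] at hy
    refine Smooth.extMul_of_diagonal (Matrix.of fun i c => y (Sum.inl (i, c)))
      (left_ne_zero_of_mul hy) (Matrix.of fun k a => y (Sum.inr (Sum.inl (k, a))))
      (right_ne_zero_of_mul hy) (fun k => y (Sum.inr (Sum.inr k))) _ _ (fun x x' => ?_) _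
      (arrayBilin_genericArray y) (fun x x' hx hx' => ?_) hp
    · simp only [LinearMap.add_apply, LinearMap.sub_apply, arrayForm_apply, hC x]
      congr 2 <;>
      · rw [Finset.sum_comm]
        exact Finset.sum_congr rfl fun k _ => Finset.sum_congr rfl fun l _ => by
          simp only [genericArray, π₀, mul_comm, Sum.elim_inr, hC]
    · have h2 : C x x' = arrayForm π₀ x x' := by
        rw [sum_sum_apply_single C x x', arrayForm_apply]
        simp [Fintype.sum_sum_type, hx, hx', π₀, mul_comm]
      rw [LinearMap.add_apply, LinearMap.sub_apply, LinearMap.add_apply, LinearMap.sub_apply, h2,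
        add_sub_cancel, arrayForm_apply]
      simp only [genericArray, map_sum, map_mul, MvPolynomial.eval_X, sum_sum_gram]
      simp [Matrix.mulVec, dotProduct, hx, hx']

end ExtMulCore

section ExtMulAbstract

variable {K : Type*} [Field K]

theorem exists_sum_coordinates {X : Type*} [AddCommGroup X] [Module K X] [Module.Finite K X]
    {s : ℕ} (π : X →ₗ[K] Fin s → K) (hπ : Function.Surjective π) :
    ∃ (t : ℕ) (e : X ≃ₗ[K] (Fin s ⊕ Fin t → K)), ∀ x j, e x (Sum.inl j) = π x j := by
  obtain ⟨Q, hQ⟩ := Submodule.exists_isCompl (LinearMap.ker π)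
  refine ⟨finrank K (LinearMap.ker π), (LinearMap.equivProdOfSurjectiveOfIsCompl π
    ((LinearMap.ker π).projectionOnto Q hQ) (LinearMap.range_eq_top.2 hπ)
    (Submodule.range_projectionOnto hQ) ?_).trans
    (((LinearEquiv.refl K _).prodCongr (finBasis K _).equivFun).trans
      (LinearEquiv.sumArrowLequivProdArrow _ _ K K).symm), fun x j => rfl⟩
  convert hQ
  ext x
  simp

theorem exists_pairing_coordinates {X W : Type*} [AddCommGroup X] [Module K X] [Module.Finite K X]
    [AddCommGroup W] [Module K W] [Module.Finite K W] (p : X →ₗ[K] W →ₗ[K] K)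
    (hp : finrank K (LinearMap.ker p.flip) = 1) :
    ∃ (s t : ℕ) (eX : X ≃ₗ[K] (Fin s ⊕ Fin t → K)) (eW : W ≃ₗ[K] (Fin s ⊕ Unit → K)),
      ∀ x w, p x w = ∑ j, eX x (Sum.inl j) * eW w (Sum.inl j) := by
  obtain ⟨Q, hQ⟩ := Submodule.exists_isCompl (LinearMap.ker p.flip)
  let v := finBasis K Q
  let π : X →ₗ[K] Fin (finrank K Q) → K := LinearMap.pi fun j => p.flip (v j)
  have hπ : Function.Surjective π := by
    rw [← LinearMap.range_eq_top]
    by_contra h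
    obtain ⟨φ, hφ, hle⟩ := Submodule.exists_le_ker_of_lt_top _ (lt_top_iff_ne_top.2 h)
    have h1 (x : X) : p x (∑ j, φ (Pi.single j 1) • v j : Q) = 0 := by
      have : φ (π x) = 0 := hle ⟨x, rfl⟩
      rw [← this]
      conv_rhs => rw [pi_eq_sum_univ' (π x)]
      simp [π, mul_comm]
    have h2 : ∑ j, φ (Pi.single j 1) • v j = 0 := by
      have := hQ.disjoint.le_bot ⟨(LinearMap.mem_ker.2 (LinearMap.ext h1) :
        (_ : W) ∈ LinearMap.ker p.flip), Subtype.prop _⟩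
      exact Subtype.ext this
    have h3 := Fintype.linearIndependent_iff.1 v.linearIndependent _ h2
    refine hφ (LinearMap.pi_ext' fun j => LinearMap.ext_ring ?_)
    simpa using h3 j
  obtain ⟨t, eX, heX⟩ := exists_sum_coordinates π hπ
  let eU : LinearMap.ker p.flip ≃ₗ[K] (Unit → K) := LinearEquiv.ofFinrankEq _ _ (by simp [hp])
  refine ⟨_, t, eX, (Submodule.prodEquivOfIsCompl _ _ hQ.symm).symm.trans
    ((v.equivFun.prodCongr eU).trans (LinearEquiv.sumArrowLequivProdArrow _ _ K K).symm),
    fun x w => ?_⟩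
  obtain ⟨⟨q, u⟩, rfl⟩ := (Submodule.prodEquivOfIsCompl _ _ hQ.symm).surjective w
  have hu : p x u = 0 := LinearMap.congr_fun (LinearMap.mem_ker.1 u.2) x
  have hq := congrArg ((p x).comp Q.subtype) (v.sum_repr q)
  simp only [map_sum, map_smul, LinearMap.comp_apply, Submodule.subtype_apply, smul_eq_mul] at hq
  have hw : p x (Submodule.prodEquivOfIsCompl _ _ hQ.symm (q, u)) = p x q := by
    simp [hu]
  simp only [hw, ← hq, heX, π, LinearMap.pi_apply, LinearMap.flip_apply, LinearEquiv.trans_apply,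
    LinearEquiv.symm_apply_apply, LinearEquiv.prodCongr_apply, mul_comm,
    LinearEquiv.sumArrowLequivProdArrow_symm_apply_inl, Basis.equivFun_apply]

theorem Smooth.extMul_of_finrank_ker [CharZero K] {X W : Type*} [AddCommGroup X] [Module K X]
    [Module.Finite K X] [AddCommGroup W] [Module K W] [Module.Finite K W]
    (B : X →ₗ[K] X →ₗ[K] W) (hB : ∀ x y, B x y = B y x) (C : LinearMap.BilinForm K X)
    (hC : ∀ x y, C x y = C y x) (p : X →ₗ[K] W →ₗ[K] K)
    (hpB : ∀ x y z, p x (B y z) = p y (B x z)) (hp : finrank K (LinearMap.ker p.flip) = 1)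
    (hW : finrank K W ≤ 4) : Smooth (extMul B C p) := by
  obtain ⟨s, t, eX, eW, h⟩ := exists_pairing_coordinates p hp
  have hs : s ≤ 3 := by
    have := eW.finrank_eq
    simp at this
    lia
  refine (Smooth.extMul_core (t := t) hs
    ((B.compl₁₂ eX.symm.toLinearMap eX.symm.toLinearMap).compr₂ eW.toLinearMap)
    (fun x y => by simp [hB (eX.symm x)]) (C.compl₁₂ eX.symm.toLinearMap eX.symm.toLinearMap)
    (fun x y => by simp [hC (eX.symm x)]) (p.compl₁₂ eX.symm.toLinearMap eW.symm.toLinearMap)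
    (fun x w => by simp [h]) fun x y z => by simp [hpB (eX.symm x)]).extMul_congr eX eW ?_ ?_ ?_
  all_goals simp

end ExtMulAbstract

section SocleDimension

variable {K : Type*} [Field K] {X W : Type*} [AddCommGroup X] [Module K X] [Module.Finite K X]
  [AddCommGroup W] [Module K W] [Module.Finite K W]

theorem Smooth.extMul_of_annihilator [CharZero K] (B : X →ₗ[K] X →ₗ[K] W)
    (hB : ∀ x y, B x y = B y x) (C : LinearMap.BilinForm K X) (hC : ∀ x y, C x y = C y x)
    (p : X →ₗ[K] W →ₗ[K] K) (hpB : ∀ x y z, p x (B y z) = p y (B x z))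
    (hp : LinearMap.ker p.flip = ⊥) (ξ : X) (hξ : ξ ≠ 0) (w₀ : W) (hξB : ∀ x, B x ξ = 0)
    (hξC : ∀ x, C x ξ + p x w₀ = 0) (hξp : p ξ = 0) (hXW : finrank K X + finrank K W ≤ 8) :
    Smooth (extMul B C p) := by
  obtain ⟨Q, hQ⟩ := Submodule.exists_isCompl (K ∙ ξ)
  have hQr : finrank K Q + 1 = finrank K X := by
    rw [← Submodule.finrank_add_eq_of_isCompl hQ, finrank_span_singleton hξ, add_comm]
  have hpQ (w : W) (hw : ∀ x : Q, p x w = 0) : w = 0 := by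
    have : w ∈ LinearMap.ker p.flip := by
      refine LinearMap.mem_ker.2 (LinearMap.ext fun x => ?_)
      obtain ⟨⟨u, x⟩, rfl⟩ := (Submodule.prodEquivOfIsCompl _ _ hQ).surjective x
      obtain ⟨c, hc⟩ := Submodule.mem_span_singleton.1 u.2
      simp [← hc, hξp, hw]
    rwa [hp] at this
  have hW : finrank K W ≤ finrank K Q := by
    rw [← Subspace.dual_finrank_eq (K := K) (V := Q)]
    refine LinearMap.finrank_le_finrank_of_injective (f := Q.subtype.dualMap ∘ₗ p.flip)
      ((injective_iff_map_eq_zero _).2 fun w hw => hpQ w fun x => LinearMap.congr_fun hw x)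
  let e₀ : Q × (W × K) × K →ₗ[K] X × W × K :=
    { toFun := fun v => (v.1 + v.2.1.2 • ξ, v.2.1.1 + v.2.1.2 • w₀, v.2.2)
      map_add' := fun v v' => by
        refine Prod.ext ?_ (Prod.ext ?_ rfl)
        · simp only [Prod.fst_add, Prod.snd_add, Submodule.coe_add]
          module
        · simp only [Prod.fst_add, Prod.snd_add]
          module
      map_smul' := fun c v => by
        simp [mul_smul] }
  have he₀ (v) : e₀ v = (v.1 + v.2.1.2 • ξ, v.2.1.1 + v.2.1.2 • w₀, v.2.2) := rfl
  have hinj : Function.Injective e₀ := by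
    refine (injective_iff_map_eq_zero e₀).2 fun v hv => ?_
    obtain ⟨x, ⟨w, q⟩, e⟩ := v
    simp only [he₀, Prod.mk_eq_zero] at hv
    obtain ⟨h1, h2, rfl⟩ := hv
    have h3 : (x : X) ∈ K ∙ ξ :=
      Submodule.mem_span_singleton.2 ⟨-q, by rw [neg_smul, neg_eq_of_add_eq_zero_left h1]⟩
    have hx : x = 0 := Subtype.ext (hQ.disjoint.le_bot ⟨h3, x.2⟩)
    subst hx
    have hq : q = 0 := by simpa [hξ] using h1
    subst hq
    simpa using h2
  let e := LinearMap.linearEquivOfInjective e₀ hinj (by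
    simp only [finrank_prod, finrank_self]
    lia)
  have h := Smooth.extMul_of_finrank_ker
    ((B.compl₁₂ Q.subtype Q.subtype).compr₂ (LinearMap.inl K W K)) (fun x y => by simp [hB (x : X)])
    (C.compl₁₂ Q.subtype Q.subtype) (fun x y => hC _ _)
    (p.compl₁₂ Q.subtype (LinearMap.fst K W K)) (fun x y z => by simp [hpB (x : X)])
    (finrank_eq_one_iff'.2 ⟨⟨(0, 1), by ext; simp⟩, fun h => one_ne_zero (α := K)
      (congrArg (fun v : LinearMap.ker _ => (v : W × K).2) h), fun ⟨⟨w, q⟩, hw⟩ => ⟨q, by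
      have : w = 0 := hpQ w fun x => LinearMap.congr_fun (LinearMap.mem_ker.1 hw) x
      ext <;> simp [this]⟩⟩) (by simp only [finrank_prod, finrank_self]; lia)
  refine h.transport e ?_
  rintro ⟨x, ⟨w, q⟩, c⟩ ⟨x', ⟨w', q'⟩, c'⟩
  have he (v) : e v = (v.1 + v.2.1.2 • ξ, v.2.1.1 + v.2.1.2 • w₀, v.2.2) := rfl
  have h1 := hξC x
  have h2 := hξC x'
  have h3 := hξC ξ
  simp only [hξp, LinearMap.zero_apply, add_zero] at h3
  simp only [he, extMul_apply]
  refine Prod.ext ?_ (Prod.ext ?_ ?_)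
  · simp
  · simp [hB ξ, hξB]
  · simp [hC ξ, hξp, h3]
    linear_combination -q' * h1 - q * h2

theorem Smooth.extMul_of_finrank_annihilator [CharZero K] (B : X →ₗ[K] X →ₗ[K] W)
    (hB : ∀ x y, B x y = B y x) (C : LinearMap.BilinForm K X) (hC : ∀ x y, C x y = C y x)
    (p : X →ₗ[K] W →ₗ[K] K) (hpB : ∀ x y z, p x (B y z) = p y (B x z))
    (hspan : Submodule.span K {w | ∃ x y, B x y = w} = ⊤)
    (hann : finrank K (⨅ x, LinearMap.ker (extMul B C p (x, 0, 0)) : Submodule K _) = 2)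
    (hX : 4 ≤ finrank K X) (hXW : finrank K X + finrank K W ≤ 8) : Smooth (extMul B C p) := by
  set S : Submodule K (X × W × K) := ⨅ x, LinearMap.ker (extMul B C p (x, 0, 0)) with hS
  have hmem (v) : v ∈ S ↔ ∀ x, B x v.1 = 0 ∧ C x v.1 + p x v.2.1 = 0 := by
    simp [hS, extMul_apply]
  by_cases hp : LinearMap.ker p.flip = ⊥
  · obtain ⟨v, hv, hv0⟩ : ∃ v ∈ S, v.1 ≠ 0 := by
      by_contra! h
      have h1 : S ≤ K ∙ ((0, 0, 1) : X × W × K) := fun v hv => by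
        have h2 : v.2.1 ∈ LinearMap.ker p.flip :=
          LinearMap.mem_ker.2 (LinearMap.ext fun x => by
            have := ((hmem v).1 hv x).2
            rwa [h v hv, map_zero, zero_add] at this)
        rw [hp, Submodule.mem_bot] at h2
        exact Submodule.mem_span_singleton.2 ⟨v.2.2, by ext <;> simp [h v hv, h2]⟩
      have h3 := Submodule.finrank_mono h1
      rw [hann, finrank_span_singleton (by simp)] at h3
      lia
    rw [hmem] at hv
    refine Smooth.extMul_of_annihilator B hB C hC p hpB hp v.1 hv0 v.2.1 (fun x => (hv x).1)
      (fun x => (hv x).2) (LinearMap.ext fun w => ?_) hXW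
    have : (⊤ : Submodule K W) ≤ LinearMap.ker (p v.1) := by
      rw [← hspan, Submodule.span_le]
      rintro _ ⟨x, y, rfl⟩
      rw [SetLike.mem_coe, LinearMap.mem_ker, hpB, hB, (hv y).1, map_zero]
    exact this trivial
  · refine Smooth.extMul_of_finrank_ker B hB C hC p hpB (le_antisymm ?_ ?_) (by lia)
    · let f : LinearMap.ker p.flip × K →ₗ[K] X × W × K :=
        (LinearMap.inr K X (W × K)).comp ((LinearMap.ker p.flip).subtype.prodMap .id)
      have hf : LinearMap.range f ≤ S := by
        rintro _ ⟨⟨w, c⟩, rfl⟩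
        rw [hmem]
        intro x
        have : p x w = 0 := LinearMap.congr_fun (LinearMap.mem_ker.1 w.2) x
        simp [f, this]
      have h1 := Submodule.finrank_mono hf
      rw [hann, LinearMap.finrank_range_of_inj, finrank_prod, finrank_self] at h1
      · lia
      · intro v v' h
        simpa [f, Prod.ext_iff] using h
    · exact Nat.one_le_iff_ne_zero.2 fun h => hp (Submodule.finrank_eq_zero.1 h)

end SocleDimension

section BlockMatrix

variable {K : Type*} [Field K] {n r : ℕ}

theorem blockMat1rn1_mulVec (b : Fin r → K) (c : Fin n → K) (D : Matrix (Fin r) (Fin n) K)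
    (f : Fin n → K) (e : K) (w : Fin r → K) (u : Fin n → K) (a : K) :
    blockMat1rn1 b c D f *ᵥ Sum.elim (fun _ => e) (Sum.elim w (Sum.elim u fun _ => a)) =
      Sum.elim (fun _ => b ⬝ᵥ w + c ⬝ᵥ u) (Sum.elim (D *ᵥ u) (Sum.elim (a • f) fun _ => 0)) := by
  funext i
  rcases i with i | i | i | i <;>
    simp [blockMat1rn1, Matrix.mulVec, dotProduct, mul_comm]

/-- The quadruples `(a, ξ, w, e)` as vectors with blocks of sizes `1, r, n, 1`, where `ξ` holds the
coordinates with respect to the family `f`. -/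
noncomputable def blockEquiv {f : Fin n → Fin n → K} (hf : LinearIndependent K f) :
    (K × (Fin n → K) × (Fin r → K) × K) ≃ₗ[K] (Fin 1 ⊕ (Fin r ⊕ (Fin n ⊕ Fin 1)) → K) :=
  LinearMap.linearEquivOfInjective
    { toFun := fun v => Sum.elim (fun _ => v.2.2.2) (Sum.elim v.2.2.1
        (Sum.elim (Fintype.linearCombination K f v.2.1) fun _ => v.1))
      map_add' := fun v v' => by
        funext i
        rcases i with i | i | i | i <;> simp
      map_smul' := fun k v => by
        funext i
        rcases i with i | i | i | i <;> simp }
    ((injective_iff_map_eq_zero _).2 fun v hv => by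
      have h1 (i) := congrFun hv (Sum.inl i)
      have h2 (i) := congrFun hv (Sum.inr (Sum.inl i))
      have h3 (i) := congrFun hv (Sum.inr (Sum.inr (Sum.inl i)))
      have h4 (i) := congrFun hv (Sum.inr (Sum.inr (Sum.inr i)))
      have h5 := Fintype.linearIndependent_iff.1 hf v.2.1 (funext h3)
      exact Prod.ext (h4 0) (Prod.ext (funext h5) (Prod.ext (funext h2) (h1 0))))
    (by
      simp only [finrank_prod, finrank_self, finrank_fintype_fun_eq_card, Fintype.card_sum,
        Fintype.card_fin]
      lia)

theorem blockEquiv_apply {f : Fin n → Fin n → K} (hf : LinearIndependent K f)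
    (v : K × (Fin n → K) × (Fin r → K) × K) :
    blockEquiv hf v = Sum.elim (fun _ => v.2.2.2) (Sum.elim v.2.2.1
      (Sum.elim (Fintype.linearCombination K f v.2.1) fun _ => v.1)) :=
  rfl

theorem apply_comm_of_single {ι M : Type*} [Fintype ι] [DecidableEq ι] [AddCommGroup M] [Module K M]
    (B : (ι → K) →ₗ[K] (ι → K) →ₗ[K] M)
    (h : ∀ i j, B (Pi.single i 1) (Pi.single j 1) = B (Pi.single j 1) (Pi.single i 1))
    (x y : ι → K) : B x y = B y x := by
  rw [sum_sum_apply_single B x y, sum_sum_apply_single B y x, Finset.sum_comm]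
  simp only [h, mul_comm]

end BlockMatrix

/-- **Proposition 5.6 (smooth1nr1), smoothability part.** Every local algebra with Hilbert
function (1,n,r,1), n ≥ 4, n + r ≤ 8, and socle dimension 2 is smoothable, in matrix form. -/
theorem stmt13 {K : Type*} [Field K] [CharZero K] [IsAlgClosed K]
    {n r : ℕ} (hn : 4 ≤ n) (hr : 1 ≤ r) (hnr : n + r ≤ 8)
    (b : Fin n → (Fin r → K)) (c : Fin n → (Fin n → K))
    (D : Fin n → Matrix (Fin r) (Fin n) K) (f : Fin n → (Fin n → K))
    (A : Fin n → Matrix (Fin 1 ⊕ (Fin r ⊕ (Fin n ⊕ Fin 1))) (Fin 1 ⊕ (Fin r ⊕ (Fin n ⊕ Fin 1))) K)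
    (hA : A = fun i => blockMat1rn1 (b i) (c i) (D i) (f i))
    (hcomm : ∀ i j, A i * A j = A j * A i)
    (hf : LinearIndependent K f)
    (hD : (⨆ i, LinearMap.range (Matrix.mulVecLin (D i))) = ⊤)
    (hb : ∃ i, b i ≠ 0)
    (hker : Module.finrank K ↥(⨅ i, LinearMap.ker (Matrix.mulVecLin (A i))) = 2) :
    InSimDiagClosure A := by
  subst hA
  let F := Fintype.linearCombination K f
  let B : (Fin n → K) →ₗ[K] (Fin n → K) →ₗ[K] (Fin r → K) :=
    (Fintype.linearCombination K fun i => (D i).mulVecLin).compl₂ F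
  let C : LinearMap.BilinForm K (Fin n → K) :=
    (Fintype.linearCombination K fun i => dotProductBilin K K (c i)).compl₂ F
  let p : (Fin n → K) →ₗ[K] (Fin r → K) →ₗ[K] K :=
    Fintype.linearCombination K fun i => dotProductBilin K K (b i)
  let z (i : Fin n) : (Fin n → K) × (Fin r → K) × K := (Pi.single i 1, 0, 0)
  have hBi (i x) : B (Pi.single i 1) x = D i *ᵥ F x := by
    simp [B, Fintype.linearCombination_apply_single]
  have hCi (i x) : C (Pi.single i 1) x = c i ⬝ᵥ F x := by
    simp [C, Fintype.linearCombination_apply_single, dotProductBilin]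
  have hpi (i w) : p (Pi.single i 1) w = b i ⬝ᵥ w := by
    simp [p, Fintype.linearCombination_apply_single, dotProductBilin]
  have hmul (i v) : blockEquiv hf (unitMul (extMul B C p) (z i) v) =
      blockMat1rn1 (b i) (c i) (D i) (f i) *ᵥ blockEquiv hf v := by
    rw [blockEquiv_apply, blockEquiv_apply, blockMat1rn1_mulVec, unitMul_apply, extMul_apply]
    simp [z, hBi, hCi, hpi, Fintype.linearCombination_apply_single, F, add_comm]
  have hcomm' (i j v) : unitMul (extMul B C p) (z i) (unitMul (extMul B C p) (z j) v) =
      unitMul (extMul B C p) (z j) (unitMul (extMul B C p) (z i) v) := by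
    apply (blockEquiv hf).injective
    simp only [hmul, Matrix.mulVec_mulVec]
    rw [hcomm i j]
  have hB : ∀ x y, B x y = B y x := apply_comm_of_single B fun i j => by
    simpa [extMul_apply, z] using congrArg (fun v => v.2.2.1) (hcomm' i j (1, 0))
  have hC : ∀ x y, C x y = C y x := apply_comm_of_single C fun i j => by
    simpa [extMul_apply, z] using congrArg (fun v => v.2.2.2) (hcomm' i j (1, 0))
  have hpB : ∀ x y w, p x (B y w) = p y (B x w) := fun x y w =>
    apply_comm_of_single (p.compl₂ (B.flip w)) (fun i j => by
      have := congrArg (fun v => v.2.2.2) (hcomm' i j (0, w, 0, 0))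
      simpa [extMul_apply, z] using this) x y
  have hF : Function.Surjective F := by
    intro v
    obtain ⟨u, hu⟩ := (blockEquiv (r := r) hf).surjective (Sum.elim 0 (Sum.elim 0 (Sum.elim v 0)))
    exact ⟨u.2.1, funext fun i => congrFun hu (Sum.inr (Sum.inr (Sum.inl i)))⟩
  have hspan : Submodule.span K {w | ∃ x y, B x y = w} = ⊤ := by
    rw [eq_top_iff, ← hD, iSup_le_iff]
    rintro i _ ⟨v, rfl⟩
    obtain ⟨y, rfl⟩ := hF v
    exact Submodule.subset_span ⟨Pi.single i 1, y, hBi i y⟩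
  have hann : finrank K (⨅ x, LinearMap.ker (extMul B C p (x, 0, 0)) : Submodule K _) = 2 := by
    let j := (blockEquiv (r := r) hf).toLinearMap ∘ₗ LinearMap.inr K K _
    have hj : Function.Injective j := (blockEquiv hf).injective.comp LinearMap.inr_injective
    rw [← hker, (Submodule.equivMapOfInjective j hj _).finrank_eq]
    refine congrArg (fun S : Submodule K _ => finrank K S) ?_
    ext u
    obtain ⟨⟨a, v⟩, rfl⟩ := (blockEquiv (r := r) hf).surjective u
    simp only [Submodule.mem_map, Submodule.mem_iInf, LinearMap.mem_ker, mulVecLin_apply, ← hmul,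
      LinearEquiv.map_eq_zero_iff]
    constructor
    · rintro ⟨v', hv', h⟩ i
      obtain ⟨rfl, rfl⟩ : 0 = a ∧ v' = v := by
        simpa using (blockEquiv hf).injective h
      simpa using hv' (Pi.single i 1)
    · intro h
      obtain rfl : a = 0 := by
        have := congrFun (congrArg (fun v => v.2.1) (h ⟨0, by lia⟩)) ⟨0, by lia⟩
        simpa [z, extMul_apply] using this
      have h1 : B.flip v.1 = 0 := LinearMap.pi_ext' fun i => LinearMap.ext_ring <| by
        simpa [extMul_apply, z] using congrArg (fun v => v.2.2.1) (h i)
      have h2 : C.flip v.1 + p.flip v.2.1 = 0 :=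
        LinearMap.pi_ext' fun i => LinearMap.ext_ring <| by
          simpa [z, extMul_apply] using congrArg (fun v => v.2.2.2) (h i)
      refine ⟨v, fun x => ?_, rfl⟩
      have h1 : B x v.1 = 0 := LinearMap.congr_fun h1 x
      have h2 : C x v.1 + p x v.2.1 = 0 := LinearMap.congr_fun h2 x
      simp [extMul_apply, h1, h2]
  have hsmooth : Smooth (extMul B C p) :=
    Smooth.extMul_of_finrank_annihilator B hB C hC p hpB hspan hann (by simpa) (by simpa)
  have := (hsmooth (Fin n) z).transport (blockEquiv hf)
    (T' := fun i => (blockMat1rn1 (b i) (c i) (D i) (f i)).mulVecLin) hmul _ (Pi.basisFun K _)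
  simpa [LinearMap.toMatrix_eq_toMatrix', ← Matrix.toLin'_apply'] using this
end
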